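/- arXiv:2310.12888 — 3 statements merged into one kernel-verified Lean document; each statement's English description precedes it below -/
import Mathlib

section
/- Let F be a field, let k, n ≥ 1, let e : Fin k → ℤ be strictly monotone (integers e_1 < e_2 < ⋯ < e_k), let K := FractionField (MvPolynomial (Fin n) F), and let α_j ∈ K be the image of the variable X_j. Let V ∈ K^{k×n} be the generic monomial matrix V_{i,j} := α_j^{e_i}. Then for every ℓ ≥ 2 and every family A_1, …, A_ℓ of subsets of {1,…,n} with |A_i| ≤ k for all i, with |A_1| + ⋯ + |A_ℓ| = (ℓ−1)·k, and having the dimension-k null intersection property, the intersection V_{A_1} ∩ ⋯ ∩ V_{A_ℓ} of the column-span subspaces is the zero subspace of K^k. (In other words, generic monomial codes are MDS(ℓ) for all ℓ ≥ 2.) -/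
open Finset Matrix

noncomputable section

/-- The intersection `⋂_{j ∈ p} A j`, as a `Finset (Fin n)`. -/
def interSet {ℓ n : ℕ} (A : Fin ℓ → Finset (Fin n)) (p : Finset (Fin ℓ)) : Finset (Fin n) :=
  Finset.univ.filter fun x => ∀ j ∈ p, x ∈ A j

/-- The dimension-`m` null intersection property: for every partition of `{1,…,ℓ}`
(presented as a `Finpartition` of `Finset.univ : Finset (Fin ℓ)`) into nonempty parts
`P_1,…,P_s`, we have `Σ_i |⋂_{j ∈ P_i} A_j| ≤ (s-1)·m`. -/
def NullInter {ℓ n : ℕ} (m : ℕ) (A : Fin ℓ → Finset (Fin n)) : Prop :=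
  ∀ P : Finpartition (Finset.univ : Finset (Fin ℓ)),
    ∑ p ∈ P.parts, (interSet A p).card ≤ (P.parts.card - 1) * m

/-- Span of the columns of `M` indexed by `A`. -/
def colSpan {K : Type*} [Field K] {k n : ℕ} (M : Matrix (Fin k) (Fin n) K)
    (A : Finset (Fin n)) : Submodule K (Fin k → K) :=
  Submodule.span K ((fun j i => M i j) '' (A : Set (Fin n)))

/-- Span of the first `σ` columns of `M`. -/
def colSpanLT {K : Type*} [Field K] {k b : ℕ} (M : Matrix (Fin k) (Fin b) K)
    (σ : ℕ) : Submodule K (Fin k → K) :=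
  Submodule.span K ((fun j i => M i j) '' {j : Fin b | (j : ℕ) < σ})

/-- The minimum of `σ` over the set `p` (for nonempty `p`, this is `min_{j ∈ p} σ j`). -/
def partMin {ℓ : ℕ} (σ : Fin ℓ → ℕ) (p : Finset (Fin ℓ)) : ℕ :=
  sInf (σ '' (p : Set (Fin ℓ)))

/-- The generic intersection dimension `gid_m((σ_i, A_i)_i)`: the maximum over all
partitions of `{1,…,ℓ}` into nonempty parts `P_1,…,P_s` of
`-m(s-1) + Σ_i (min_{j ∈ P_i} σ_j + |⋂_{j ∈ P_i} A_j|)`. -/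
def gid {ℓ n : ℕ} (m : ℕ) (σ : Fin ℓ → ℕ) (A : Fin ℓ → Finset (Fin n)) : ℤ :=
  sSup { v : ℤ | ∃ P : Finpartition (Finset.univ : Finset (Fin ℓ)),
    v = -(m : ℤ) * ((P.parts.card : ℤ) - 1)
      + ∑ p ∈ P.parts, ((partMin σ p : ℤ) + ((interSet A p).card : ℤ)) }


namespace GMC

open MvPolynomial

variable {F : Type*} [Field F] {n k ℓ : ℕ}

/-- Substituting `0` for the variable `X j`. -/
def red (j : Fin n) : MvPolynomial (Fin n) F →ₐ[F] MvPolynomial (Fin n) F :=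
  aeval (fun i => if i = j then 0 else X i)

lemma X_dvd_sub_red (j : Fin n) (p : MvPolynomial (Fin n) F) : X j ∣ p - red j p := by
  induction p using MvPolynomial.induction_on with
  | C a => simp [red]
  | add p q hp hq =>
    have := dvd_add hp hq
    rw [map_add]
    convert this using 1
    ring
  | mul_X p i hp =>
    rw [map_mul]
    by_cases h : i = j
    · subst h
      simp [red]
    · have : red j (X i : MvPolynomial (Fin n) F) = X i := by simp [red, h]
      rw [this, ← sub_mul]
      exact dvd_mul_of_dvd_left hp _

lemma core (j : Fin n) {κ : Type*} (T : (κ → MvPolynomial (Fin n) F) → Prop)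
    (hdiv : ∀ u : κ → MvPolynomial (Fin n) F, T (fun x => X j * u x) → T u)
    (hred : ∀ u : κ → MvPolynomial (Fin n) F, T u → ∀ x, red j (u x) = 0) :
    ∀ u : κ → MvPolynomial (Fin n) F, T u → ∀ x, u x = 0 := by
  have key : ∀ N : ℕ, ∀ u : κ → MvPolynomial (Fin n) F, T u → ∀ x, X j ^ N ∣ u x := by
    intro N
    induction N with
    | zero => intro u _ x; simp
    | succ N ih =>
      intro u hu
      have h1 : ∀ x, ∃ v, u x = X j * v := by
        intro x
        have := X_dvd_sub_red j (u x)
        rw [hred u hu x, sub_zero] at this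
        exact this
      choose v hv using h1
      have hu' : u = fun x => X j * v x := funext hv
      have hTv : T v := hdiv v (hu' ▸ hu)
      intro x
      rw [hv x, pow_succ']
      exact mul_dvd_mul_left _ (ih v hTv x)
  intro u hu x
  by_contra hne
  have hX : ¬ IsUnit (X j : MvPolynomial (Fin n) F) := by
    intro h
    have h2 := h.map (red j)
    simp [red] at h2
  obtain ⟨N, hN⟩ := FiniteMultiplicity.of_not_isUnit hX hne
  exact hN (key _ u hu x)

/-- The dual constraints. -/
def Con (e : Fin k → ℕ) (d : ℕ) (A : Finset (Fin n))
    (u : Fin k → MvPolynomial (Fin n) F) : Prop :=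
  (∀ m : Fin k, (m : ℕ) < d → u m = 0) ∧ ∀ j ∈ A, ∑ m, u m * X j ^ e m = 0

lemma Con.div {e : Fin k → ℕ} {d : ℕ} {A : Finset (Fin n)} {j : Fin n}
    {u : Fin k → MvPolynomial (Fin n) F} (h : Con e d A (fun m => X j * u m)) :
    Con e d A u := by
  refine ⟨fun m hm => ?_, fun i hi => ?_⟩
  · have := h.1 m hm
    simpa [X_ne_zero] using this
  · have := h.2 i hi
    simp only [mul_assoc] at this
    rw [← Finset.mul_sum] at this
    simpa [X_ne_zero] using this

lemma Con.red {e : Fin k → ℕ} (he : StrictMono e) {d : ℕ} {A : Finset (Fin n)} (j : Fin n)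
    {u : Fin k → MvPolynomial (Fin n) F} (h : Con e d A u) :
    Con e (if j ∈ A then d + 1 else d) (A.erase j) (fun m => red j (u m)) := by
  have hlow : ∀ m : Fin k, (m : ℕ) < d → GMC.red j (u m) = 0 := by
    intro m hm
    rw [h.1 m hm, map_zero]
  refine ⟨fun m hm => ?_, fun i hi => ?_⟩
  · split_ifs at hm with hj
    · rcases Nat.lt_succ_iff_lt_or_eq.mp hm with h1 | h1
      · exact hlow m h1
      · have h2 := h.2 j hj
        have h3 : ∑ m', u m' * X j ^ e m' =
            X j ^ e m * (u m + ∑ m' ∈ Finset.univ.erase m, u m' * X j ^ (e m' - e m)) := by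
          rw [← Finset.add_sum_erase _ _ (Finset.mem_univ m), mul_add, mul_comm, Finset.mul_sum]
          congr 1
          refine Finset.sum_congr rfl fun m' hm' => ?_
          have hne : m' ≠ m := Finset.ne_of_mem_erase hm'
          rcases lt_or_gt_of_ne hne with hlt | hgt
          · have : u m' = 0 := h.1 m' (by have : (m' : ℕ) < m := hlt; omega)
            simp [this]
          · have : e m < e m' := he hgt
            rw [mul_left_comm, ← pow_add]
            congr 2
            omega
        rw [h3] at h2
        have h4 : u m + ∑ m' ∈ Finset.univ.erase m, u m' * X j ^ (e m' - e m) = 0 := by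
          simpa [X_ne_zero] using h2
        have h5 := congrArg (GMC.red j) h4
        rw [map_add, map_sum, map_zero, Finset.sum_eq_zero, add_zero] at h5
        · exact h5
        · intro m' hm'
          have hne : m' ≠ m := Finset.ne_of_mem_erase hm'
          rcases lt_or_gt_of_ne hne with hlt | hgt
          · have : u m' = 0 := h.1 m' (by have : (m' : ℕ) < m := hlt; omega)
            simp [this]
          · have : e m < e m' := he hgt
            have h6 : e m' - e m ≠ 0 := by omega
            simp [GMC.red, h6]
    · exact hlow m hm
  · have hne : i ≠ j := Finset.ne_of_mem_erase hi
    have := congrArg (GMC.red j) (h.2 i (Finset.mem_of_mem_erase hi))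
    simpa [GMC.red, hne] using this

/-- Generalised Vandermonde. -/
lemma vandermonde {e : Fin k → ℕ} (he : StrictMono e) :
    ∀ (N d : ℕ) (A : Finset (Fin n)), A.card = N → k ≤ d + A.card →
    ∀ u : Fin k → MvPolynomial (Fin n) F, Con e d A u → ∀ m, u m = 0 := by
  intro N
  induction N with
  | zero =>
    intro d A hA hk u hu m
    exact hu.1 m (by have := m.2; omega)
  | succ N ih =>
    intro d A hA hk
    obtain ⟨j, hj⟩ : A.Nonempty := Finset.card_pos.mp (by omega)
    refine core j (fun u => Con e d A u) (fun u h => h.div) ?_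
    intro u hu m
    have h1 := hu.red he j
    rw [if_pos hj] at h1
    have hc : (A.erase j).card = N := by rw [Finset.card_erase_of_mem hj]; omega
    exact ih (d + 1) (A.erase j) hc (by omega) _ h1 m

lemma mem_interSet {A : Fin ℓ → Finset (Fin n)} {P : Finset (Fin ℓ)} {x : Fin n} :
    x ∈ interSet A P ↔ ∀ i ∈ P, x ∈ A i := by
  simp [interSet]

/-- The combinatorial condition. -/
def Hyp (k : ℕ) (I : Finset (Fin ℓ)) (d : Fin ℓ → ℕ) (A : Fin ℓ → Finset (Fin n)) : Prop :=
  (∀ i ∈ I, d i + (A i).card ≤ k) ∧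
  ∀ P ⊆ I, P.Nonempty → ∃ i ∈ P,
    ∑ i ∈ P, (k - d i - (A i).card) + d i + (interSet A P).card ≤ k

lemma Hyp.mono {I J : Finset (Fin ℓ)} {d : Fin ℓ → ℕ} {A : Fin ℓ → Finset (Fin n)}
    (h : Hyp k I d A) (hJ : J ⊆ I) : Hyp k J d A :=
  ⟨fun i hi => h.1 i (hJ hi), fun P hP => h.2 P (hP.trans hJ)⟩

variable (F) in
/-- Independence of the dual spaces. -/
def Indep (e : Fin k → ℕ) (I : Finset (Fin ℓ)) (d : Fin ℓ → ℕ)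
    (A : Fin ℓ → Finset (Fin n)) : Prop :=
  ∀ u : Fin ℓ → Fin k → MvPolynomial (Fin n) F, (∀ i ∈ I, Con e (d i) (A i) (u i)) →
    (∀ m, ∑ i ∈ I, u i m = 0) → ∀ i ∈ I, ∀ m, u i m = 0

/-- Degeneration preserves dependence. -/
lemma Indep.degen {e : Fin k → ℕ} (he : StrictMono e) {I : Finset (Fin ℓ)} {d : Fin ℓ → ℕ}
    {A : Fin ℓ → Finset (Fin n)} (j : Fin n)
    (h : Indep F e I (fun i => if j ∈ A i then d i + 1 else d i) (fun i => (A i).erase j)) :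
    Indep F e I d A := by
  have := core (F := F) j (κ := I × Fin k)
    (fun w => ∃ u : Fin ℓ → Fin k → MvPolynomial (Fin n) F, (∀ x, w x = u x.1 x.2) ∧
      (∀ i ∈ I, Con e (d i) (A i) (u i)) ∧ (∀ m, ∑ i ∈ I, u i m = 0)) ?_ ?_
  · intro u h1 h2 i hi m
    exact this (fun x => u x.1 x.2) ⟨u, fun _ => rfl, h1, h2⟩ (⟨i, hi⟩, m)
  · rintro w ⟨u, hw, h1, h2⟩
    refine ⟨fun i m => if hi : i ∈ I then w (⟨i, hi⟩, m) else 0, ?_, ?_, ?_⟩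
    · rintro ⟨⟨i, hi⟩, m⟩
      simp [hi]
    · intro i hi
      apply Con.div (j := j)
      have : (fun m => X j * (if hi : i ∈ I then w (⟨i, hi⟩, m) else 0)) = u i := by
        funext m
        simp only [hi, dif_pos]
        exact hw (⟨i, hi⟩, m)
      rw [this]
      exact h1 i hi
    · intro m
      have h3 := h2 m
      have : ∑ i ∈ I, u i m = X j * ∑ i ∈ I, (if hi : i ∈ I then w (⟨i, hi⟩, m) else 0) := by
        rw [Finset.mul_sum]
        refine Finset.sum_congr rfl fun i hi => ?_
        simp only [hi, dif_pos]
        exact (hw (⟨i, hi⟩, m)).symm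
      rw [this] at h3
      simpa [X_ne_zero] using h3
  · rintro w ⟨u, hw, h1, h2⟩ ⟨⟨i, hi⟩, m⟩
    rw [hw]
    refine h (fun i m => red j (u i m)) (fun i hi => (h1 i hi).red he j) ?_ i hi m
    intro m
    rw [← map_sum, h2, map_zero]

/-- Dropping a member of codimension zero. -/
lemma Indep.drop {e : Fin k → ℕ} (he : StrictMono e) {I : Finset (Fin ℓ)} {d : Fin ℓ → ℕ}
    {A : Fin ℓ → Finset (Fin n)} {i₀ : Fin ℓ} (hi₀ : i₀ ∈ I) (hc : k ≤ d i₀ + (A i₀).card)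
    (h : Indep F e (I.erase i₀) d A) : Indep F e I d A := by
  intro u h1 h2
  have h3 := vandermonde he _ (d i₀) (A i₀) rfl hc (u i₀) (h1 i₀ hi₀)
  have h4 := h u (fun i hi => h1 i (Finset.mem_of_mem_erase hi)) (fun m => by
    have := h2 m
    rwa [← Finset.add_sum_erase _ _ hi₀, h3, zero_add] at this)
  intro i hi
  by_cases h5 : i = i₀
  · subst h5; exact h3
  · exact h4 i (Finset.mem_erase.mpr ⟨h5, hi⟩)

/-- Increasing the unique minimum. -/
lemma Indep.bump {e : Fin k → ℕ} {I : Finset (Fin ℓ)} {d : Fin ℓ → ℕ}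
    {A : Fin ℓ → Finset (Fin n)} {i₀ : Fin ℓ} (hi₀ : i₀ ∈ I)
    (hmin : ∀ i ∈ I, i ≠ i₀ → d i₀ < d i)
    (h : Indep F e I (Function.update d i₀ (d i₀ + 1)) A) : Indep F e I d A := by
  intro u h1 h2
  refine h u ?_ h2
  intro i hi
  by_cases h5 : i = i₀
  · subst h5
    rw [Function.update_self]
    refine ⟨fun m hm => ?_, (h1 i hi).2⟩
    rcases Nat.lt_succ_iff_lt_or_eq.mp hm with h6 | h6
    · exact (h1 i hi).1 m h6
    · have := h2 m
      rw [← Finset.add_sum_erase _ _ hi, Finset.sum_eq_zero, add_zero] at this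
      · exact this
      · intro i' hi'
        have h7 := hmin i' (Finset.mem_of_mem_erase hi') (Finset.ne_of_mem_erase hi')
        exact (h1 i' (Finset.mem_of_mem_erase hi')).1 m (by omega)
  · rw [Function.update_of_ne h5]
    exact h1 i hi

/-- Merging. -/
lemma Indep.merge {e : Fin k → ℕ} {I P : Finset (Fin ℓ)} {d : Fin ℓ → ℕ}
    {A : Fin ℓ → Finset (Fin n)} (hPI : P ⊆ I) {p : Fin ℓ} (hp : p ∈ P)
    (hmin : ∀ i ∈ P, d p ≤ d i)
    (hP : Indep F e P d A)
    (h : Indep F e (insert p (I \ P)) d (Function.update A p (interSet A P))) :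
    Indep F e I d A := by
  intro u h1 h2
  have hpn : p ∉ I \ P := by simp [hp]
  have hne : ∀ i ∈ I \ P, i ≠ p := fun i hi h => hpn (h ▸ hi)
  have key := h (Function.update u p (fun m => ∑ i ∈ P, u i m)) ?_ ?_
  · have h3 : ∀ m, ∑ i ∈ P, u i m = 0 := by
      intro m
      simpa using key p (Finset.mem_insert_self _ _) m
    have h4 := hP u (fun i hi => h1 i (hPI hi)) h3
    intro i hi m
    by_cases hiP : i ∈ P
    · exact h4 i hiP m
    · have hi' : i ∈ I \ P := Finset.mem_sdiff.mpr ⟨hi, hiP⟩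
      have := key i (Finset.mem_insert_of_mem hi') m
      rwa [Function.update_of_ne (hne i hi')] at this
  · intro i hi
    rcases Finset.mem_insert.mp hi with rfl | hi'
    · simp only [Function.update_self]
      refine ⟨fun m hm => Finset.sum_eq_zero fun i' hi' =>
        (h1 i' (hPI hi')).1 m (lt_of_lt_of_le hm (hmin i' hi')), fun j hj => ?_⟩
      simp only [Finset.sum_mul]
      rw [Finset.sum_comm]
      refine Finset.sum_eq_zero fun i' hi' => (h1 i' (hPI hi')).2 j ?_
      exact (Finset.mem_filter.mp hj).2 i' hi'
    · rw [Function.update_of_ne (hne i hi'), Function.update_of_ne (hne i hi')]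
      exact h1 i (Finset.mem_sdiff.mp hi').1
  · intro m
    rw [Finset.sum_insert hpn, Function.update_self, ← h2 m, ← Finset.sum_sdiff hPI, add_comm]
    congr 1
    refine Finset.sum_congr rfl fun i hi => ?_
    rw [Function.update_of_ne (hne i hi)]

lemma Hyp.merge {I P : Finset (Fin ℓ)} {d : Fin ℓ → ℕ}
    {A : Fin ℓ → Finset (Fin n)} (hPI : P ⊆ I) {p : Fin ℓ} (hp : p ∈ P)
    (hmin : ∀ i ∈ P, d p ≤ d i) (h : Hyp k I d A)
    (htight : k ≤ ∑ i ∈ P, (k - d i - (A i).card) + d p + (interSet A P).card) :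
    Hyp k (insert p (I \ P)) d (Function.update A p (interSet A P)) := by
  have hpn : p ∉ I \ P := by simp [hp]
  have hne : ∀ i ∈ I \ P, i ≠ p := fun i hi h => hpn (h ▸ hi)
  have hsub : interSet A P ⊆ A p := fun x hx => (Finset.mem_filter.mp hx).2 p hp
  refine ⟨?_, ?_⟩
  · intro i hi
    rcases Finset.mem_insert.mp hi with rfl | hi'
    · rw [Function.update_self]
      have := h.1 i (hPI hp)
      have := Finset.card_le_card hsub
      omega
    · rw [Function.update_of_ne (hne i hi')]
      exact h.1 i (Finset.mem_sdiff.mp hi').1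
  · intro Q hQ hQn
    by_cases hpQ : p ∈ Q
    · have hQ' : Q.erase p ⊆ I \ P := by
        intro i hi
        rcases Finset.mem_insert.mp (hQ (Finset.mem_of_mem_erase hi)) with h1 | h1
        · exact absurd h1 (Finset.ne_of_mem_erase hi)
        · exact h1
      have hdisj : Disjoint (Q.erase p) P := by
        refine Finset.disjoint_left.mpr fun i hi hiP => ?_
        exact (Finset.mem_sdiff.mp (hQ' hi)).2 hiP
      obtain ⟨i, hi, hle⟩ := h.2 (Q.erase p ∪ P)
        (Finset.union_subset (hQ'.trans Finset.sdiff_subset) hPI) ⟨p, by simp [hp]⟩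
      rw [Finset.sum_union hdisj] at hle
      have hint : interSet (Function.update A p (interSet A P)) Q
          = interSet A (Q.erase p ∪ P) := by
        ext x
        rw [mem_interSet, mem_interSet]
        simp only [Finset.mem_union]
        constructor
        · rintro hx i (hi | hi)
          · have := hx i (Finset.mem_of_mem_erase hi)
            rwa [Function.update_of_ne (Finset.ne_of_mem_erase hi)] at this
          · have := hx p hpQ
            rw [Function.update_self] at this
            exact mem_interSet.mp this i hi
        · intro hx i hi
          by_cases hip : i = p
          · subst hip
            rw [Function.update_self]
            rw [mem_interSet]
            exact fun i' hi' => hx i' (Or.inr hi')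
          · rw [Function.update_of_ne hip]
            exact hx i (Or.inl (Finset.mem_erase.mpr ⟨hip, hi⟩))
      have hs : ∑ i ∈ Q.erase p, (k - d i - (Function.update A p (interSet A P) i).card)
          = ∑ i ∈ Q.erase p, (k - d i - (A i).card) :=
        Finset.sum_congr rfl fun i hi => by
          rw [Function.update_of_ne (Finset.ne_of_mem_erase hi)]
      rw [hint, ← Finset.add_sum_erase _ _ hpQ, hs, Function.update_self]
      rcases Finset.mem_union.mp hi with hi | hi
      · exact ⟨i, Finset.mem_of_mem_erase hi, by omega⟩
      · have := hmin i hi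
        exact ⟨p, hpQ, by omega⟩
    · have hQ' : Q ⊆ I \ P := by
        intro i hi
        rcases Finset.mem_insert.mp (hQ hi) with h1 | h1
        · exact absurd (h1 ▸ hi) hpQ
        · exact h1
      obtain ⟨i, hi, hle⟩ := h.2 Q (hQ'.trans Finset.sdiff_subset) hQn
      refine ⟨i, hi, ?_⟩
      have hint : interSet (Function.update A p (interSet A P)) Q = interSet A Q := by
        ext x
        rw [mem_interSet, mem_interSet]
        refine forall₂_congr fun i hi => ?_
        rw [Function.update_of_ne (hne i (hQ' hi))]
      have hs : ∑ i ∈ Q, (k - d i - (Function.update A p (interSet A P) i).card)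
          = ∑ i ∈ Q, (k - d i - (A i).card) :=
        Finset.sum_congr rfl fun i hi => by
          rw [Function.update_of_ne (hne i (hQ' hi))]
      rw [hint, hs]
      exact hle

lemma Hyp.bump {I : Finset (Fin ℓ)} {d : Fin ℓ → ℕ}
    {A : Fin ℓ → Finset (Fin n)} {i₀ : Fin ℓ} (hi₀ : i₀ ∈ I)
    (hc : d i₀ + (A i₀).card < k) (h : Hyp k I d A) :
    Hyp k I (Function.update d i₀ (d i₀ + 1)) A := by
  refine ⟨fun i hi => ?_, fun P hP hPn => ?_⟩
  · by_cases h5 : i = i₀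
    · subst h5; rw [Function.update_self]; omega
    · rw [Function.update_of_ne h5]; exact h.1 i hi
  · obtain ⟨i, hi, hle⟩ := h.2 P hP hPn
    refine ⟨i, hi, ?_⟩
    by_cases hP0 : i₀ ∈ P
    · rw [← Finset.add_sum_erase _ _ hP0] at hle ⊢
      have hs : ∑ i ∈ P.erase i₀, (k - Function.update d i₀ (d i₀ + 1) i - (A i).card)
          = ∑ i ∈ P.erase i₀, (k - d i - (A i).card) :=
        Finset.sum_congr rfl fun i hi => by
          rw [Function.update_of_ne (Finset.ne_of_mem_erase hi)]
      rw [hs, Function.update_self]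
      have : Function.update d i₀ (d i₀ + 1) i ≤ d i + 1 := by
        by_cases h5 : i = i₀
        · subst h5; rw [Function.update_self]
        · rw [Function.update_of_ne h5]; omega
      omega
    · have hs : ∑ i ∈ P, (k - Function.update d i₀ (d i₀ + 1) i - (A i).card)
          = ∑ i ∈ P, (k - d i - (A i).card) :=
        Finset.sum_congr rfl fun i hi => by
          rw [Function.update_of_ne (fun h5 => hP0 (by rwa [h5] at hi))]
      rw [hs, Function.update_of_ne (fun h5 => hP0 (by rwa [h5] at hi))]
      exact hle

lemma Hyp.degen {I : Finset (Fin ℓ)} {d : Fin ℓ → ℕ}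
    {A : Fin ℓ → Finset (Fin n)} {i₀ : Fin ℓ} (hi₀ : i₀ ∈ I) (hmin : ∀ i ∈ I, d i₀ ≤ d i)
    (j : Fin n) (hj : j ∉ A i₀) (h : Hyp k I d A)
    (hnt : ∀ P ⊂ I, 2 ≤ P.card → ∃ i ∈ P,
      ∑ i ∈ P, (k - d i - (A i).card) + d i + (interSet A P).card < k) :
    Hyp k I (fun i => if j ∈ A i then d i + 1 else d i) (fun i => (A i).erase j) := by
  have hsame : ∀ i, (if j ∈ A i then d i + 1 else d i) + ((A i).erase j).card
      = d i + (A i).card := by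
    intro i
    split_ifs with hji
    · rw [Finset.card_erase_of_mem hji]
      have : 0 < (A i).card := Finset.card_pos.mpr ⟨j, hji⟩
      omega
    · rw [Finset.erase_eq_of_notMem hji]
  have hle : ∀ i, (if j ∈ A i then d i + 1 else d i) ≤ d i + 1 := by
    intro i; split_ifs <;> omega
  refine ⟨fun i hi => ?_, fun P hP hPn => ?_⟩
  · simp only [hsame]; exact h.1 i hi
  · have hint : (interSet (fun i => (A i).erase j) P).card ≤ (interSet A P).card := by
      apply Finset.card_le_card
      intro x hx
      simp only [interSet, Finset.mem_filter, Finset.mem_univ, true_and] at hx ⊢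
      exact fun i hi => Finset.mem_of_mem_erase (hx i hi)
    have hs : ∑ i ∈ P, (k - (if j ∈ A i then d i + 1 else d i) - ((A i).erase j).card)
        = ∑ i ∈ P, (k - d i - (A i).card) :=
      Finset.sum_congr rfl fun i hi => by
        rw [Nat.sub_sub, hsame, Nat.sub_sub]
    simp only [hs]
    by_cases hPI : P = I
    · subst hPI
      obtain ⟨i, hi, hle⟩ := h.2 P hP hPn
      refine ⟨i₀, hi₀, ?_⟩
      rw [if_neg hj]
      have := hmin i hi
      omega
    · by_cases hc : 2 ≤ P.card
      · obtain ⟨i, hi, hlt⟩ := hnt P (Finset.ssubset_iff_subset_ne.mpr ⟨hP, hPI⟩) hc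
        refine ⟨i, hi, ?_⟩
        have := hle i
        omega
      · have h1 : P.card = 1 := by
          have := Finset.card_pos.mpr hPn
          omega
        obtain ⟨i, rfl⟩ := Finset.card_eq_one.mp h1
        refine ⟨i, Finset.mem_singleton_self i, ?_⟩
        rw [Finset.sum_singleton]
        have h2 : interSet (fun i => (A i).erase j) {i} = (A i).erase j := by
          ext x; simp [interSet]
        rw [h2]
        have := hsame i
        have := h.1 i (hP (Finset.mem_singleton_self i))
        omega

/-- The main induction. -/
theorem main {e : Fin k → ℕ} (he : StrictMono e) :
    ∀ (N M : ℕ) (I : Finset (Fin ℓ)) (d : Fin ℓ → ℕ) (A : Fin ℓ → Finset (Fin n)),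
      I.card = N → ∑ i ∈ I, (k - d i) = M → Hyp k I d A → Indep F e I d A := by
  intro N
  induction N using Nat.strong_induction_on with
  | _ N ihN =>
  intro M
  induction M using Nat.strong_induction_on with
  | _ M ihM =>
  intro I d A hN hM h
  rcases I.eq_empty_or_nonempty with rfl | hIn
  · intro u _ _ i hi
    simp at hi
  by_cases ht : ∃ P, P ⊂ I ∧ 2 ≤ P.card ∧ ∀ i ∈ P,
      k ≤ ∑ i ∈ P, (k - d i - (A i).card) + d i + (interSet A P).card
  · obtain ⟨P, hPI, hP2, htight⟩ := ht
    obtain ⟨p, hp, hmin⟩ := Finset.exists_min_image P d (Finset.card_pos.mp (by omega))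
    have hlt := Finset.card_lt_card hPI
    refine Indep.merge hPI.1 hp hmin
      (ihN P.card (by omega) _ P d A rfl rfl (h.mono hPI.1))
      (ihN _ ?_ _ _ d _ rfl rfl (h.merge hPI.1 hp hmin (htight p hp)))
    have h1 := Finset.card_insert_le p (I \ P)
    have h2 := Finset.card_sdiff_add_card_eq_card hPI.1
    omega
  push Not at ht
  obtain ⟨i₀, hi₀, hmin⟩ := Finset.exists_min_image I d hIn
  have hdrop : k ≤ d i₀ + (A i₀).card → Indep F e I d A := by
    intro hc
    refine Indep.drop he hi₀ hc (ihN _ ?_ _ _ d A rfl rfl (h.mono (Finset.erase_subset _ _)))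
    rw [← hN]
    exact Finset.card_erase_lt_of_mem hi₀
  by_cases hc : k ≤ d i₀ + (A i₀).card
  · exact hdrop hc
  push Not at hc
  -- degeneration
  by_cases hdeg : ∃ i₁ ∈ I, d i₁ = d i₀ ∧ ∃ j, j ∉ A i₁ ∧ ∃ i ∈ I, j ∈ A i
  · obtain ⟨i₁, hi₁, hd, j, hj, i, hi, hji⟩ := hdeg
    refine Indep.degen he j (ihM _ ?_ I _ _ hN rfl
      (h.degen hi₁ (fun i hi => hd ▸ hmin i hi) j hj ht))
    rw [← hM]
    refine Finset.sum_lt_sum (fun i _ => ?_) ⟨i, hi, ?_⟩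
    · split_ifs <;> omega
    · rw [if_pos hji]
      have := h.1 i hi
      have : 0 < (A i).card := Finset.card_pos.mpr ⟨j, hji⟩
      omega
  push Not at hdeg
  by_cases huniq : ∀ i ∈ I, i ≠ i₀ → d i₀ < d i
  · refine Indep.bump hi₀ huniq (ihM _ ?_ I _ _ hN rfl (h.bump hi₀ hc))
    rw [← hM]
    refine Finset.sum_lt_sum (fun i _ => ?_) ⟨i₀, hi₀, ?_⟩
    · by_cases h5 : i = i₀
      · subst h5; rw [Function.update_self]; omega
      · rw [Function.update_of_ne h5]
    · rw [Function.update_self]; omega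
  push Not at huniq
  obtain ⟨i₁, hi₁, hne, hle⟩ := huniq
  have hd : d i₁ = d i₀ := le_antisymm hle (hmin i₁ hi₁)
  have hA : A i₁ = A i₀ := by
    ext x
    constructor
    · intro hx
      by_contra hx'
      exact hdeg i₀ hi₀ rfl x hx' i₁ hi₁ hx
    · intro hx
      by_contra hx'
      exact hdeg i₁ hi₁ hd x hx' i₀ hi₀ hx
  exfalso
  obtain ⟨i, hi, hle⟩ := h.2 {i₀, i₁} (by
    intro x hx
    rcases Finset.mem_insert.mp hx with rfl | hx
    · exact hi₀
    · rw [Finset.mem_singleton.mp hx]; exact hi₁) ⟨i₀, by simp⟩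
  rw [Finset.sum_pair (Ne.symm hne), hd, hA] at hle
  have hint : interSet A {i₀, i₁} = A i₀ := by
    ext x; simp [interSet, hA]
  rw [hint] at hle
  have : d i = d i₀ := by
    rcases Finset.mem_insert.mp hi with rfl | hx
    · rfl
    · rw [Finset.mem_singleton.mp hx]; exact hd
  omega

/-- From the null intersection property to the combinatorial condition. -/
lemma hyp_of_nullInter {A : Fin ℓ → Finset (Fin n)} (hℓ : 1 ≤ ℓ) (hA : ∀ i, (A i).card ≤ k)
    (hsum : (∑ i, (A i).card) = (ℓ - 1) * k) (h : NullInter k A) :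
    Hyp k Finset.univ (fun _ => 0) A := by
  refine ⟨fun i _ => by simpa using hA i, fun P _ hP => ?_⟩
  obtain ⟨p, hp⟩ := hP
  refine ⟨p, hp, ?_⟩
  show ∑ i ∈ P, (k - 0 - (A i).card) + 0 + (interSet A P).card ≤ k
  have hsing : ∀ i, interSet A {i} = A i := by intro i; ext x; simp [interSet]
  have hinj : Function.Injective (fun i : Fin ℓ => ({i} : Finset (Fin ℓ))) :=
    Finset.singleton_injective
  have hnotin : P ∉ Pᶜ.image (fun i : Fin ℓ => ({i} : Finset (Fin ℓ))) := by
    intro hmem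
    obtain ⟨i, hi, hiP⟩ := Finset.mem_image.mp hmem
    rw [Finset.mem_compl] at hi
    exact hi (hiP ▸ Finset.mem_singleton_self i)
  let Q : Finpartition (Finset.univ : Finset (Fin ℓ)) :=
    { parts := insert P (Pᶜ.image (fun i : Fin ℓ => ({i} : Finset (Fin ℓ))))
      supIndep := by
        rw [Finset.supIndep_iff_pairwiseDisjoint]
        intro a ha b hb hab
        simp only [Finset.coe_insert, Set.mem_insert_iff, Finset.mem_coe, Finset.mem_image,
          Finset.mem_compl] at ha hb
        simp only [Function.onFun, id]
        rcases ha with rfl | ⟨i, hi, rfl⟩ <;> rcases hb with rfl | ⟨i', hi', rfl⟩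
        · exact absurd rfl hab
        · simpa using hi'
        · simpa using hi
        · rw [Finset.disjoint_singleton]
          rintro rfl
          exact hab rfl
      sup_parts := by
        apply Finset.eq_univ_of_forall
        intro x
        rw [Finset.mem_sup]
        by_cases hx : x ∈ P
        · exact ⟨P, Finset.mem_insert_self _ _, hx⟩
        · exact ⟨{x}, Finset.mem_insert_of_mem
            (Finset.mem_image.mpr ⟨x, Finset.mem_compl.mpr hx, rfl⟩),
            Finset.mem_singleton_self x⟩
      bot_notMem := by
        intro hmem
        rcases Finset.mem_insert.mp hmem with h1 | h1
        · rw [← h1] at hp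
          simp at hp
        · obtain ⟨i, _, hi⟩ := Finset.mem_image.mp h1
          simp at hi }
  have hQ := h Q
  have hparts : Q.parts = insert P (Pᶜ.image (fun i : Fin ℓ => ({i} : Finset (Fin ℓ)))) := rfl
  rw [hparts, Finset.sum_insert hnotin, Finset.card_insert_of_notMem hnotin,
    Finset.card_image_of_injective _ hinj, Finset.sum_image (fun _ _ _ _ h => hinj h),
    Nat.add_sub_cancel] at hQ
  simp only [hsing] at hQ
  have h1 : ∑ i ∈ P, (k - 0 - (A i).card) + ∑ i ∈ P, (A i).card = P.card * k := by
    rw [← Finset.sum_add_distrib, Finset.sum_congr rfl (g := fun _ => k)]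
    · simp
    · intro i _
      have := hA i
      omega
  have h2 := Finset.sum_add_sum_compl P (fun i => (A i).card)
  have h3 : P.card + Pᶜ.card = ℓ := by
    rw [Finset.card_add_card_compl]; simp
  have h4 : (ℓ - 1) * k + k = P.card * k + Pᶜ.card * k := by
    rw [← add_mul, h3]
    obtain ⟨q, rfl⟩ : ∃ q, ℓ = q + 1 := ⟨ℓ - 1, by omega⟩
    rw [Nat.add_sub_cancel, add_mul, one_mul]
  omega

theorem final {F : Type*} [Field F] (k n : ℕ) (hk : 1 ≤ k)
    (K : Type*) [Field K] [Algebra (MvPolynomial (Fin n) F) K]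
    [IsFractionRing (MvPolynomial (Fin n) F) K]
    (e : Fin k → ℤ) (he : StrictMono e)
    (V : Matrix (Fin k) (Fin n) K)
    (hV : ∀ i j, V i j =
      (algebraMap (MvPolynomial (Fin n) F) K (MvPolynomial.X j)) ^ (e i))
    (ℓ : ℕ) (hℓ : 2 ≤ ℓ) (A : Fin ℓ → Finset (Fin n))
    (hA : ∀ i, (A i).card ≤ k)
    (hsum : (∑ i, (A i).card) = (ℓ - 1) * k)
    (hNI : NullInter k A) :
    (⨅ i, colSpan V (A i)) = ⊥ := by
  let z : Fin k := ⟨0, hk⟩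
  have hz : ∀ m, e z ≤ e m := fun m => he.monotone (Fin.mk_le_of_le_val (Nat.zero_le _))
  let e' : Fin k → ℕ := fun m => (e m - e z).toNat
  have he' : StrictMono e' := by
    intro a b hab
    have h1 := he hab
    have h2 := hz a
    have h3 := hz b
    simp only [e']
    omega
  have hInd : GMC.Indep F e' Finset.univ (fun _ : Fin ℓ => 0) A :=
    GMC.main he' _ _ _ _ _ rfl rfl (GMC.hyp_of_nullInter (by omega) hA hsum hNI)
  have hX0 : ∀ j : Fin n, algebraMap (MvPolynomial (Fin n) F) K (MvPolynomial.X j) ≠ 0 := by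
    intro j
    rw [Ne, IsFractionRing.to_map_eq_zero_iff]
    exact MvPolynomial.X_ne_zero j
  let L : (i : Fin ℓ) → (Fin k → K) →ₗ[K] (A i → K) := fun i =>
    { toFun := fun w j => ∑ m, w m * V m j
      map_add' := by intro a b; funext j; simp [add_mul, Finset.sum_add_distrib]
      map_smul' := by intro c a; funext j; simp [Finset.mul_sum, mul_assoc] }
  let U : Fin ℓ → Submodule K (Fin k → K) := fun i => LinearMap.ker (L i)
  have hU : ∀ i w, w ∈ U i ↔ ∀ j ∈ A i, ∑ m, w m * V m j = 0 := by
    intro i w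
    rw [LinearMap.mem_ker]
    constructor
    · intro h j hj
      exact congrFun h ⟨j, hj⟩
    · intro h
      funext j
      exact h j j.2
  have hdim : ∀ i, k ≤ Module.finrank K (U i) + (A i).card := by
    intro i
    have h1 := LinearMap.finrank_range_add_finrank_ker (L i)
    have h2 := Submodule.finrank_le (LinearMap.range (L i))
    simp only [Module.finrank_fintype_fun_eq_card, Fintype.card_fin, Fintype.card_coe] at h1 h2
    have h3 : Module.finrank K (U i) = Module.finrank K (LinearMap.ker (L i)) := rfl
    omega
  let Φ : ((i : Fin ℓ) → U i) →ₗ[K] (Fin k → K) :=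
    ∑ i, (U i).subtype ∘ₗ LinearMap.proj i
  have hΦ : ∀ u, Φ u = ∑ i, (u i : Fin k → K) := by
    intro u
    simp [Φ, LinearMap.sum_apply]
  have hinj : Function.Injective Φ := by
    rw [← LinearMap.ker_eq_bot, LinearMap.ker_eq_bot']
    intro u hu
    rw [hΦ] at hu
    obtain ⟨b, hb⟩ := IsLocalization.exist_integer_multiples_of_finite (nonZeroDivisors (MvPolynomial (Fin n) F))
      (fun x : Fin ℓ × Fin k => (u x.1 : Fin k → K) x.2)
    choose v hv using hb
    have hb0 : algebraMap (MvPolynomial (Fin n) F) K b ≠ 0 := by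
      rw [Ne, IsFractionRing.to_map_eq_zero_iff]
      exact nonZeroDivisors.ne_zero b.2
    have hv' : ∀ i m, algebraMap (MvPolynomial (Fin n) F) K (v (i, m)) = algebraMap (MvPolynomial (Fin n) F) K b * (u i : Fin k → K) m := by
      intro i m
      rw [hv (i, m), Algebra.smul_def]
    have hzero := hInd (fun i m => v (i, m)) ?_ ?_
    · funext i
      apply Subtype.ext
      funext m
      have h1 := hv' i m
      rw [hzero i (Finset.mem_univ i) m, map_zero] at h1
      simpa [hb0] using h1.symm
    · intro i _
      refine ⟨fun m hm => absurd hm (Nat.not_lt_zero _), fun j hj => ?_⟩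
      apply IsFractionRing.injective (MvPolynomial (Fin n) F) K
      rw [map_zero, map_sum]
      have h1 := (hU i _).mp (u i).2 j hj
      have h2 : ∀ m, algebraMap (MvPolynomial (Fin n) F) K (v (i, m) * MvPolynomial.X j ^ e' m)
          = algebraMap (MvPolynomial (Fin n) F) K b * (algebraMap (MvPolynomial (Fin n) F) K (MvPolynomial.X j)) ^ (- e z) *
            ((u i : Fin k → K) m * V m j) := by
        intro m
        rw [map_mul, map_pow, hv', hV]
        have h3 : (algebraMap (MvPolynomial (Fin n) F) K (MvPolynomial.X j)) ^ e' m
            = (algebraMap (MvPolynomial (Fin n) F) K (MvPolynomial.X j)) ^ (- e z) *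
              (algebraMap (MvPolynomial (Fin n) F) K (MvPolynomial.X j)) ^ (e m) := by
          rw [← zpow_add₀ (hX0 j), ← zpow_natCast]
          congr 1
          have := hz m
          simp only [e']
          omega
        rw [h3]
        ring
      rw [Finset.sum_congr rfl (fun m _ => h2 m), ← Finset.mul_sum, h1, mul_zero]
    · intro m
      apply IsFractionRing.injective (MvPolynomial (Fin n) F) K
      rw [map_zero, map_sum, Finset.sum_congr rfl (fun i _ => hv' i m), ← Finset.mul_sum]
      have h1 := congrFun hu m
      rw [Finset.sum_apply] at h1
      rw [h1]
      simp
  have hsurj : Function.Surjective Φ := by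
    have h1 := LinearMap.finrank_le_finrank_of_injective hinj
    have h2 : Module.finrank K ((i : Fin ℓ) → U i) = ∑ i, Module.finrank K (U i) :=
      Module.finrank_pi_fintype K
    have h3 : Module.finrank K (Fin k → K) = k := by simp
    have h4 : ∑ _i : Fin ℓ, k ≤ ∑ i, (Module.finrank K (U i) + (A i).card) :=
      Finset.sum_le_sum fun i _ => hdim i
    rw [Finset.sum_add_distrib, hsum, Finset.sum_const, Finset.card_univ, Fintype.card_fin,
      smul_eq_mul] at h4
    have h5 : ℓ * k = (ℓ - 1) * k + k := by
      obtain ⟨q, rfl⟩ : ∃ q, ℓ = q + 1 := ⟨ℓ - 1, by omega⟩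
      rw [Nat.add_sub_cancel, add_mul, one_mul]
    exact (LinearMap.injective_iff_surjective_of_finrank_eq_finrank (by omega)).mp hinj
  rw [eq_bot_iff]
  intro x hx
  rw [Submodule.mem_iInf] at hx
  have horth : ∀ i, ∀ w ∈ U i, ∑ m, w m * x m = 0 := by
    intro i w hw
    have h1 := hx i
    unfold colSpan at h1
    clear hx
    induction h1 using Submodule.span_induction with
    | mem y hy =>
      obtain ⟨j, hj, rfl⟩ := hy
      exact (hU i w).mp hw j hj
    | zero => simp
    | add a b _ _ ha hb => simp [mul_add, Finset.sum_add_distrib, ha, hb]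
    | smul c a _ ha =>
      simp only [Pi.smul_apply, smul_eq_mul, mul_left_comm _ c]
      rw [← Finset.mul_sum, ha, mul_zero]
  rw [Submodule.mem_bot]
  funext m
  obtain ⟨u, hu⟩ := hsurj (Pi.single m 1)
  rw [hΦ] at hu
  have h1 : ∑ m', (Pi.single m 1 : Fin k → K) m' * x m' = x m := by
    simp [Pi.single_apply]
  rw [← hu] at h1
  simp only [Finset.sum_apply, Finset.sum_mul] at h1
  rw [Finset.sum_comm] at h1
  rw [← h1]
  exact Finset.sum_eq_zero fun i _ => horth i _ (u i).2

end GMC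

/-- Generic monomial codes are `MDS(ℓ)` for all `ℓ ≥ 2`. -/
theorem generic_monomial_codes_MDS
    (F : Type*) [Field F] (k n : ℕ) (hk : 1 ≤ k) (hn : 1 ≤ n)
    (e : Fin k → ℤ) (he : StrictMono e)
    (V : Matrix (Fin k) (Fin n) (FractionRing (MvPolynomial (Fin n) F)))
    (hV : ∀ i j, V i j =
      (algebraMap (MvPolynomial (Fin n) F) (FractionRing (MvPolynomial (Fin n) F))
        (MvPolynomial.X j)) ^ (e i)) :
    ∀ ℓ : ℕ, 2 ≤ ℓ → ∀ A : Fin ℓ → Finset (Fin n),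
      (∀ i, (A i).card ≤ k) →
      (∑ i, (A i).card) = (ℓ - 1) * k →
      NullInter k A →
      (⨅ i, colSpan V (A i)) = ⊥ := by
  intro ℓ hℓ A hA hsum hNI
  exact GMC.final k n hk _ e he V hV ℓ hℓ A hA hsum hNI
end
end

section
/- Let F be a field, let 1 ≤ k ≤ n, let e : Fin k → ℤ be strictly monotone, let K := FractionField (MvPolynomial (Fin n) F), let α_j ∈ K be the image of the variable X_j, and let V ∈ K^{k×n} be the generic monomial matrix V_{i,j} := α_j^{e_i}. Then V has rank k, and every dual matrix Q ∈ K^{(n−k)×n} of V (i.e. Q of rank n−k with V · Qᵀ = 0) satisfies: for every ℓ ≥ 2 and every family A_1, …, A_ℓ of subsets of {1,…,n} with |A_i| ≤ n−k for all i, with |A_1| + ⋯ + |A_ℓ| = (ℓ−1)·(n−k), and having the dimension-(n−k) null intersection property, the intersection Q_{A_1} ∩ ⋯ ∩ Q_{A_ℓ} of the column-span subspaces is the zero subspace of K^{n−k}. (In other words, generic monomial codes are LD-MDS(≤ L) for all L.) -/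
open Finset Matrix

noncomputable section

section GMMDS

open MvPolynomial in
/-- Degeneration `X_m → ∞`: extracting top coefficients in the variable `X_m`. -/
lemma limit_step {σ ι F : Type*} [Fintype σ] [DecidableEq σ] [Field F]
    (e : ℕ → ℕ) (k : ℕ) (he : ∀ a b, a < b → b < k → e a < e b) (he0 : ∀ a, a < k → 0 < e a)
    (m : σ) (s : Finset ι) (B : ι → Finset σ) (κ : ι → ℕ) (c : ι → σ → MvPolynomial σ F)
    (hκ : ∀ i ∈ s, κ i ≤ k)
    (hsupp : ∀ i ∈ s, ∀ j, j ∉ B i → c i j = 0)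
    (heq : ∀ i ∈ s, ∀ t, t < κ i → ∑ j, c i j * X j ^ e t = 0)
    (hsum : ∀ j, ∑ i ∈ s, c i j = 0)
    (hne : ∃ i ∈ s, ∃ j, c i j ≠ 0) :
    ∃ c' : ι → σ → MvPolynomial σ F,
      (∀ i ∈ s, ∀ j, j ∉ (if κ i = 0 then B i else (B i).erase m) → c' i j = 0) ∧
      (∀ i ∈ s, ∀ t, t < (if m ∈ B i then κ i - 1 else κ i) → ∑ j, c' i j * X j ^ e t = 0) ∧
      (∀ j, ∑ i ∈ s, c' i j = 0) ∧
      (∃ i ∈ s, ∃ j, c' i j ≠ 0) := by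
  classical
  let φ : MvPolynomial σ F →ₐ[F] Polynomial (MvPolynomial σ F) :=
    aeval (fun j => if j = m then Polynomial.X else Polynomial.C (X j))
  have hφm : φ (X m) = Polynomial.X := by simp [φ]
  have hφj : ∀ j, j ≠ m → φ (X j) = Polynomial.C (X j) := by
    intro j hj; simp [φ, hj]
  have hφinj : ∀ p, φ p = 0 → p = 0 := by
    intro p hp
    have h1 : ∀ p, Polynomial.eval (X m) (φ p) = p := by
      intro p
      induction p using MvPolynomial.induction_on with
      | C a =>
        have : φ (C a) = Polynomial.C (C a) := by
          simp only [φ, aeval_C]; rfl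
        rw [this, Polynomial.eval_C]
      | add p q hp hq => rw [map_add, Polynomial.eval_add, hp, hq]
      | mul_X p j hp =>
        rw [map_mul, Polynomial.eval_mul, hp]
        by_cases hj : j = m
        · subst hj; rw [hφm, Polynomial.eval_X]
        · rw [hφj j hj, Polynomial.eval_C]
    rw [← h1 p, hp, Polynomial.eval_zero]
  let d : ℕ := (s ×ˢ (Finset.univ : Finset σ)).sup (fun x => (φ (c x.1 x.2)).natDegree)
  have hd : ∀ i ∈ s, ∀ j, (φ (c i j)).natDegree ≤ d := by
    intro i hi j
    exact Finset.le_sup (f := fun x : ι × σ => (φ (c x.1 x.2)).natDegree)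
      (b := (i, j)) (by simp [hi])
  have heqφ : ∀ i ∈ s, ∀ t, t < κ i →
      φ (c i m) * Polynomial.X ^ e t +
        ∑ j ∈ Finset.univ.erase m, φ (c i j) * Polynomial.C (X j ^ e t) = 0 := by
    intro i hi t ht
    have h := congrArg φ (heq i hi t ht)
    rw [map_sum, map_zero, ← Finset.add_sum_erase _ _ (Finset.mem_univ m)] at h
    rw [← h]
    congr 1
    · rw [map_mul, map_pow, hφm]
    · refine Finset.sum_congr rfl fun j hj => ?_
      rw [map_mul, map_pow φ, hφj j (Finset.ne_of_mem_erase hj), Polynomial.C_pow]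
  have hdeg : ∀ i ∈ s, φ (c i m) ≠ 0 → ∀ t, t < κ i → (φ (c i m)).natDegree + e t ≤ d := by
    intro i hi h0 t ht
    have h1 := eq_neg_of_add_eq_zero_left (heqφ i hi t ht)
    rw [← Polynomial.natDegree_mul_X_pow (e t) h0, h1, Polynomial.natDegree_neg]
    refine Polynomial.natDegree_sum_le_of_forall_le _ _ fun j _ => ?_
    exact (Polynomial.natDegree_mul_C_le _ _).trans (hd i hi j)
  refine ⟨fun i j => (φ (c i j)).coeff d, ?_, ?_, ?_, ?_⟩
  · intro i hi j hj
    by_cases hB : j ∈ B i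
    · by_cases hk : κ i = 0
      · simp [hk, hB] at hj
      · simp only [hk, if_false, Finset.mem_erase, hB, and_true, not_not] at hj
        subst hj
        by_cases h0 : φ (c i j) = 0
        · simp [h0]
        · apply Polynomial.coeff_eq_zero_of_natDegree_lt
          have h1 := hdeg i hi h0 (κ i - 1) (by omega)
          have h2 := he0 (κ i - 1) (by have := hκ i hi; omega)
          omega
    · simp [hsupp i hi j hB]
  · intro i hi t ht
    have htκ : t < κ i := by split_ifs at ht <;> omega
    have h1 := congrArg (fun p => Polynomial.coeff p d) (heqφ i hi t htκ)
    simp only [Polynomial.coeff_add, Polynomial.finsetSum_coeff, Polynomial.coeff_mul_C,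
      Polynomial.coeff_zero] at h1
    have hz : (φ (c i m) * Polynomial.X ^ e t).coeff d = 0 := by
      by_cases h0 : φ (c i m) = 0
      · simp [h0]
      · have hm : m ∈ B i := by
          by_contra hm; exact h0 (by rw [hsupp i hi m hm, map_zero])
        rw [if_pos hm] at ht
        apply Polynomial.coeff_eq_zero_of_natDegree_lt
        rw [Polynomial.natDegree_mul_X_pow _ h0]
        have h2 := hdeg i hi h0 (κ i - 1) (by omega)
        have h3 := he t (κ i - 1) ht (by have := hκ i hi; omega)
        omega
    have hz' : (φ (c i m)).coeff d = 0 := by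
      by_cases h0 : φ (c i m) = 0
      · simp [h0]
      · apply Polynomial.coeff_eq_zero_of_natDegree_lt
        have h2 := hdeg i hi h0 t htκ
        have h3 := he0 t (by have := hκ i hi; omega)
        omega
    rw [hz, zero_add] at h1
    rw [← Finset.add_sum_erase _ _ (Finset.mem_univ m), h1, add_zero]
    change (φ (c i m)).coeff d * _ = 0
    rw [hz', zero_mul]
  · intro j
    have h := congrArg (fun p => (φ p).coeff d) (hsum j)
    simpa only [map_sum, Polynomial.finsetSum_coeff, map_zero, Polynomial.coeff_zero] using h
  · obtain ⟨i1, hi1, j1, hj1⟩ := hne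
    obtain ⟨⟨i, j⟩, hx, hxd⟩ := Finset.exists_mem_eq_sup (s ×ˢ (Finset.univ : Finset σ))
      ⟨(i1, j1), by simp [hi1]⟩ (fun x => (φ (c x.1 x.2)).natDegree)
    by_cases h0 : φ (c i j) = 0
    · have hd0 : d = 0 := by
        change d = _ at hxd
        rw [hxd]; simp [h0]
      refine ⟨i1, hi1, j1, ?_⟩
      have h1 := hd i1 hi1 j1
      have h2 : d = (φ (c i1 j1)).natDegree := by omega
      rw [h2]
      intro h
      exact hj1 (hφinj _ (Polynomial.leadingCoeff_eq_zero.mp h))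
    · refine ⟨i, (Finset.mem_product.mp hx).1, j, ?_⟩
      change d = _ at hxd
      rw [hxd]
      intro h
      exact h0 (Polynomial.leadingCoeff_eq_zero.mp h)

open MvPolynomial in
/-- The GM-MDS theorem for duals of (chains of) generic monomial codes. -/
lemma gm_mds_core {σ ι F : Type*} [Fintype σ] [DecidableEq σ] [DecidableEq ι] [Field F]
    (e : ℕ → ℕ) (k : ℕ) (he : ∀ a b, a < b → b < k → e a < e b) (he0 : ∀ a, a < k → 0 < e a)
    (N : ℕ) : ∀ (s : Finset ι) (B : ι → Finset σ) (κ : ι → ℕ) (c : ι → σ → MvPolynomial σ F),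
    s.card + ∑ i ∈ s, (B i).card ≤ N →
    (∀ i ∈ s, κ i ≤ k) →
    (∀ i ∈ s, κ i ≤ (B i).card) →
    (∀ I, I ⊆ s → I.Nonempty → ∃ i0 ∈ I,
      ∑ i ∈ I, (B i).card + κ i0 ≤ (I.biUnion B).card + ∑ i ∈ I, κ i) →
    (∀ i ∈ s, ∀ j, j ∉ B i → c i j = 0) →
    (∀ i ∈ s, ∀ t, t < κ i → ∑ j, c i j * X j ^ e t = 0) →
    (∀ j, ∑ i ∈ s, c i j = 0) →
    ∀ i ∈ s, ∀ j, c i j = 0 := by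
  induction N with
  | zero =>
    intro s B κ c hN _ _ _ _ _ _ i hi
    have : s.card = 0 := by omega
    rw [Finset.card_eq_zero] at this
    simp [this] at hi
  | succ N ih =>
    intro s B κ c hN hκk hκB hcond hsupp heq hsum
    by_cases htight : ∃ I, I ⊂ s ∧ 1 < I.card ∧ ∃ i0 ∈ I, (∀ i ∈ I, κ i0 ≤ κ i) ∧
        (I.biUnion B).card + ∑ i ∈ I, κ i ≤ ∑ i ∈ I, (B i).card + κ i0
    · -- merge a tight subfamily
      obtain ⟨I, hIs, hI1, i0, hi0, hmin, htI⟩ := htight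
      have hIsub := hIs.1
      have hcardI : I.card < s.card := Finset.card_lt_card hIs
      have hsplitB : ∑ i ∈ s \ I, (B i).card + ∑ i ∈ I, (B i).card = ∑ i ∈ s, (B i).card :=
        Finset.sum_sdiff hIsub
      have hunionle : (I.biUnion B).card ≤ ∑ i ∈ I, (B i).card := Finset.card_biUnion_le
      have hcsd : (s \ I).card + I.card = s.card := Finset.card_sdiff_add_card_eq_card hIsub
      have hi0n : i0 ∉ s \ I := by simp [hi0]
      let B' : ι → Finset σ := Function.update B i0 (I.biUnion B)
      let c' : ι → σ → MvPolynomial σ F := Function.update c i0 (fun j => ∑ i ∈ I, c i j)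
      have hB'0 : B' i0 = I.biUnion B := Function.update_self ..
      have hc'0 : c' i0 = fun j => ∑ i ∈ I, c i j := Function.update_self ..
      have hne : ∀ i ∈ s \ I, i ≠ i0 := fun i hi h => hi0n (h ▸ hi)
      have hB' : ∀ i, i ≠ i0 → B' i = B i := fun i h => Function.update_of_ne h ..
      have hc' : ∀ i, i ≠ i0 → c' i = c i := fun i h => Function.update_of_ne h ..
      have key := ih (insert i0 (s \ I)) B' κ c' ?_ ?_ ?_ ?_ ?_ ?_ ?_
      · have hrest : ∀ i ∈ s \ I, ∀ j, c i j = 0 := by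
          intro i hi j
          rw [← hc' i (hne i hi)]
          exact key i (Finset.mem_insert_of_mem hi) j
        have hIsum : ∀ j, ∑ i ∈ I, c i j = 0 := by
          intro j
          have := key i0 (Finset.mem_insert_self _ _) j
          rwa [hc'0] at this
        have hin := ih I B κ c (by omega) (fun i hi => hκk i (hIsub hi))
          (fun i hi => hκB i (hIsub hi)) (fun J hJ => hcond J (hJ.trans hIsub))
          (fun i hi => hsupp i (hIsub hi)) (fun i hi => heq i (hIsub hi)) hIsum
        intro i hi
        by_cases hiI : i ∈ I
        · exact hin i hiI
        · exact hrest i (Finset.mem_sdiff.mpr ⟨hi, hiI⟩)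
      · rw [Finset.card_insert_of_notMem hi0n, Finset.sum_insert hi0n, hB'0,
          Finset.sum_congr rfl (fun i hi => by rw [hB' i (hne i hi)])]
        omega
      · intro i hi
        rcases Finset.mem_insert.mp hi with rfl | hi
        · exact hκk _ (hIsub hi0)
        · exact hκk _ (Finset.mem_sdiff.mp hi).1
      · intro i hi
        rcases Finset.mem_insert.mp hi with rfl | hi
        · rw [hB'0]
          exact (hκB _ (hIsub hi0)).trans
            (Finset.card_le_card (Finset.subset_biUnion_of_mem B hi0))
        · rw [hB' i (hne i hi)]
          exact hκB _ (Finset.mem_sdiff.mp hi).1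
      · intro J hJ hJne
        by_cases hJ0 : i0 ∈ J
        · -- J contains the merged index
          have hJs : J.erase i0 ⊆ s \ I := by
            intro x hx
            have := hJ (Finset.mem_of_mem_erase hx)
            rcases Finset.mem_insert.mp this with h | h
            · exact absurd h (Finset.ne_of_mem_erase hx)
            · exact h
          have hdisj : Disjoint (J.erase i0) I :=
            Finset.disjoint_left.mpr fun x hx => (Finset.mem_sdiff.mp (hJs hx)).2
          have hUs : J.erase i0 ∪ I ⊆ s :=
            Finset.union_subset (hJs.trans Finset.sdiff_subset) hIsub
          obtain ⟨i1, hi1, h1⟩ := hcond (J.erase i0 ∪ I) hUs ⟨i0, by simp [hi0]⟩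
          rw [Finset.sum_union hdisj, Finset.sum_union hdisj] at h1
          have hbu : J.biUnion B' = (J.erase i0 ∪ I).biUnion B := by
            rw [← Finset.insert_erase hJ0, Finset.biUnion_insert, hB'0, Finset.erase_insert_eq_erase,
              Finset.union_biUnion, Finset.union_comm]
            congr 1
            · rw [Finset.erase_idem]
              exact Finset.biUnion_congr rfl fun i hi => hB' i (Finset.ne_of_mem_erase hi)
          have hs1 : ∑ i ∈ J, (B' i).card = (I.biUnion B).card + ∑ i ∈ J.erase i0, (B i).card := by
            rw [← Finset.add_sum_erase _ _ hJ0, hB'0]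
            congr 1
            exact Finset.sum_congr rfl fun i hi => by rw [hB' i (Finset.ne_of_mem_erase hi)]
          have hs2 : ∑ i ∈ J, κ i = κ i0 + ∑ i ∈ J.erase i0, κ i :=
            (Finset.add_sum_erase _ _ hJ0).symm
          rw [hbu, hs1, hs2]
          rcases Finset.mem_union.mp hi1 with h | h
          · exact ⟨i1, Finset.mem_of_mem_erase h, by omega⟩
          · have := hmin i1 h
            exact ⟨i0, hJ0, by omega⟩
        · have hJs : J ⊆ s \ I := by
            intro x hx
            rcases Finset.mem_insert.mp (hJ hx) with h | h
            · exact absurd (h ▸ hx) hJ0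
            · exact h
          obtain ⟨i1, hi1, h1⟩ := hcond J (hJs.trans Finset.sdiff_subset) hJne
          refine ⟨i1, hi1, ?_⟩
          rw [Finset.sum_congr rfl (fun i hi => by rw [hB' i (hne i (hJs hi))]),
            Finset.biUnion_congr rfl (fun i hi => hB' i (hne i (hJs hi)))]
          exact h1
      · intro i hi j hj
        rcases Finset.mem_insert.mp hi with rfl | hi
        · rw [hB'0] at hj
          rw [hc'0]
          refine Finset.sum_eq_zero fun i2 hi2 => hsupp i2 (hIsub hi2) j fun h => hj ?_
          exact Finset.mem_biUnion.mpr ⟨i2, hi2, h⟩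
        · rw [hB' i (hne i hi)] at hj
          rw [hc' i (hne i hi)]
          exact hsupp i (Finset.mem_sdiff.mp hi).1 j hj
      · intro i hi t ht
        rcases Finset.mem_insert.mp hi with rfl | hi
        · rw [hc'0]
          simp only [Finset.sum_mul]
          rw [Finset.sum_comm]
          exact Finset.sum_eq_zero fun i2 hi2 =>
            heq i2 (hIsub hi2) t (lt_of_lt_of_le ht (hmin i2 hi2))
        · rw [hc' i (hne i hi)]
          exact heq i (Finset.mem_sdiff.mp hi).1 t ht
      · intro j
        rw [Finset.sum_insert hi0n, hc'0,
          Finset.sum_congr rfl (fun i hi => by rw [hc' i (hne i hi)]), add_comm,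
          Finset.sum_sdiff hIsub]
        exact hsum j
    · rcases s.eq_empty_or_nonempty with rfl | hsne
      · simp
      obtain ⟨i0, hi0, hmin⟩ := Finset.exists_min_image s κ hsne
      by_cases hm : ∃ m ∈ B i0, ∃ i ∈ s, 0 < κ i ∧ m ∈ B i
      · obtain ⟨m, hm0, i1, hi1, hκ1, hm1⟩ := hm
        by_contra hcon
        push Not at hcon
        obtain ⟨c', h1, h2, h3, h4⟩ := limit_step e k he he0 m s B κ c hκk hsupp heq hsum hcon
        obtain ⟨i2, hi2, j2, hne2⟩ := h4
        let B' : ι → Finset σ := fun i => if κ i = 0 then B i else (B i).erase m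
        let κ' : ι → ℕ := fun i => if m ∈ B i then κ i - 1 else κ i
        have hB'le : ∀ i, B' i ⊆ B i := by
          intro i; simp only [B']; split_ifs
          · exact Finset.Subset.refl _
          · exact Finset.erase_subset _ _
        have hB'ge : ∀ i, (B i).erase m ⊆ B' i := by
          intro i; simp only [B']; split_ifs
          · exact Finset.erase_subset _ _
          · exact Finset.Subset.refl _
        have hκ'le : ∀ i, κ' i ≤ κ i := by
          intro i; simp only [κ']; split_ifs <;> omega
        have hbal : ∀ i, (B' i).card + κ i = (B i).card + κ' i := by
          intro i
          simp only [B', κ']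
          by_cases hk : κ i = 0
          · simp [hk]
          · by_cases hmi : m ∈ B i
            · have := Finset.card_pos.mpr ⟨m, hmi⟩
              rw [if_neg hk, if_pos hmi, Finset.card_erase_of_mem hmi]
              omega
            · rw [if_neg hk, if_neg hmi, Finset.erase_eq_of_notMem hmi]
        refine hne2 (ih s B' κ' c' ?_ ?_ ?_ ?_ h1 h2 h3 i2 hi2 j2)
        · have : ∑ i ∈ s, (B' i).card < ∑ i ∈ s, (B i).card := by
            refine Finset.sum_lt_sum (fun i _ => Finset.card_le_card (hB'le i)) ⟨i1, hi1, ?_⟩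
            have := hbal i1
            have h5 : κ' i1 = κ i1 - 1 := if_pos hm1
            omega
          omega
        · intro i hi
          exact (hκ'le i).trans (hκk i hi)
        · intro i hi
          have := hbal i
          have := hκB i hi
          omega
        · intro I hI hIne
          have hbalI : ∑ i ∈ I, (B' i).card + ∑ i ∈ I, κ i
              = ∑ i ∈ I, (B i).card + ∑ i ∈ I, κ' i := by
            rw [← Finset.sum_add_distrib, ← Finset.sum_add_distrib]
            exact Finset.sum_congr rfl fun i _ => hbal i
          have hU : (I.biUnion B).erase m ⊆ I.biUnion B' := by
            intro x hx
            obtain ⟨hxm, hx⟩ := Finset.mem_erase.mp hx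
            obtain ⟨i, hi, hxi⟩ := Finset.mem_biUnion.mp hx
            exact Finset.mem_biUnion.mpr ⟨i, hi, hB'ge i (Finset.mem_erase.mpr ⟨hxm, hxi⟩)⟩
          have hU1 := Finset.card_le_card hU
          have hU2 : (I.biUnion B).card - 1 ≤ ((I.biUnion B).erase m).card :=
            Finset.pred_card_le_card_erase
          by_cases hi0I : i0 ∈ I
          · obtain ⟨i3, hi3, h5⟩ := hcond I hI hIne
            have h6 := hmin i3 (hI hi3)
            refine ⟨i0, hi0I, ?_⟩
            by_cases hk0 : κ i0 = 0
            · have hUU : I.biUnion B ⊆ I.biUnion B' := by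
                intro x hx
                by_cases hxm : x = m
                · subst hxm
                  refine Finset.mem_biUnion.mpr ⟨i0, hi0I, ?_⟩
                  simpa [B', hk0] using hm0
                · exact hU (Finset.mem_erase.mpr ⟨hxm, hx⟩)
              have := Finset.card_le_card hUU
              have := hκ'le i0
              omega
            · have h7 : κ' i0 = κ i0 - 1 := if_pos hm0
              omega
          · by_cases hI1 : 1 < I.card
            · obtain ⟨i3, hi3, hmin3⟩ := Finset.exists_min_image I κ hIne
              have hss : I ⊂ s := ⟨hI, fun h => hi0I (h hi0)⟩
              have h5 : ¬ ((I.biUnion B).card + ∑ i ∈ I, κ i ≤ ∑ i ∈ I, (B i).card + κ i3) :=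
                fun h => htight ⟨I, hss, hI1, i3, hi3, hmin3, h⟩
              refine ⟨i3, hi3, ?_⟩
              have := hκ'le i3
              omega
            · have hI1' : I.card = 1 := by
                have := Finset.card_pos.mpr hIne
                omega
              obtain ⟨i, rfl⟩ := Finset.card_eq_one.mp hI1'
              exact ⟨i, by simp, by simp⟩
      · -- `B i0` is disjoint from all other sets
        push Not at hm
        have hk0 : κ i0 = 0 := by
          by_contra hk
          have h1 : 0 < (B i0).card := by have := hκB i0 hi0; omega
          obtain ⟨m, hm1⟩ := Finset.card_pos.mp h1
          exact hm m hm1 i0 hi0 (by omega) hm1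
        have hdis : ∀ i ∈ s, i ≠ i0 → ∀ j ∈ B i0, j ∉ B i := by
          intro i hi hne j hj hji
          by_cases hk : κ i = 0
          · obtain ⟨i3, hi3, h5⟩ := hcond {i0, i}
              (by intro x hx; simp only [Finset.mem_insert, Finset.mem_singleton] at hx
                  rcases hx with rfl | rfl <;> assumption) ⟨i0, by simp⟩
            rw [Finset.sum_pair hne.symm, Finset.sum_pair hne.symm, hk0, hk] at h5
            have h6 : ({i0, i} : Finset ι).biUnion B = B i0 ∪ B i := by
              simp [Finset.biUnion_insert]
            rw [h6] at h5
            have h7 := Finset.card_union_add_card_inter (B i0) (B i)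
            have h8 : 0 < (B i0 ∩ B i).card :=
              Finset.card_pos.mpr ⟨j, Finset.mem_inter.mpr ⟨hj, hji⟩⟩
            omega
          · exact hm j hj i hi (by omega) hji
        have hc0 : ∀ j, c i0 j = 0 := by
          intro j
          by_cases hj : j ∈ B i0
          · have := hsum j
            rwa [Finset.sum_eq_single_of_mem i0 hi0
              (fun i hi hne => hsupp i hi j (hdis i hi hne j hj))] at this
          · exact hsupp i0 hi0 j hj
        have hsub := Finset.erase_subset i0 s
        have hcard := Finset.card_erase_add_one hi0
        have hsB := Finset.add_sum_erase s (fun i => (B i).card) hi0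
        have hin := ih (s.erase i0) B κ c (by omega) (fun i hi => hκk i (hsub hi))
          (fun i hi => hκB i (hsub hi)) (fun J hJ => hcond J (hJ.trans hsub))
          (fun i hi => hsupp i (hsub hi)) (fun i hi => heq i (hsub hi))
          (fun j => by
            have h := hsum j
            rw [← Finset.add_sum_erase _ _ hi0, hc0 j, zero_add] at h
            exact h)
        intro i hi
        by_cases h : i = i0
        · rw [h]; exact hc0
        · exact hin i (Finset.mem_erase.mpr ⟨h, hi⟩)

/-- Version over the fraction field, with integer exponents and all dimensions equal. -/
lemma gm_mds_frac {F : Type*} [Field F] {k n ℓ : ℕ}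
    (e : Fin k → ℤ) (he : StrictMono e)
    (B : Fin ℓ → Finset (Fin n))
    (c : Fin ℓ → Fin n → FractionRing (MvPolynomial (Fin n) F))
    (hkB : ∀ i, k ≤ (B i).card)
    (hcond : ∀ I : Finset (Fin ℓ), I.Nonempty →
      ∑ i ∈ I, (B i).card + k ≤ (I.biUnion B).card + I.card * k)
    (hsupp : ∀ i, ∀ j, j ∉ B i → c i j = 0)
    (heq : ∀ i, ∀ t, ∑ j, c i j * (algebraMap (MvPolynomial (Fin n) F)
      (FractionRing (MvPolynomial (Fin n) F)) (MvPolynomial.X j)) ^ (e t) = 0)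
    (hsum : ∀ j, ∑ i, c i j = 0) : ∀ i j, c i j = 0 := by
  classical
  let R := MvPolynomial (Fin n) F
  let K := FractionRing R
  let a : Fin n → K := fun j => algebraMap R K (MvPolynomial.X j)
  have ha : ∀ j, a j ≠ 0 := by
    intro j h
    have := (IsFractionRing.injective R K) (h.trans (map_zero _).symm)
    exact MvPolynomial.X_ne_zero j this
  obtain ⟨S, hS⟩ : ∃ S : ℤ, ∀ t, 0 < e t + S := by
    refine ⟨∑ t, |e t| + 1, fun t => ?_⟩
    have h1 : |e t| ≤ ∑ t, |e t| :=
      Finset.single_le_sum (f := fun t => |e t|) (fun i _ => abs_nonneg _) (Finset.mem_univ t)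
    have := neg_abs_le (e t)
    omega
  let e' : ℕ → ℕ := fun t => if h : t < k then (e ⟨t, h⟩ + S).toNat else 0
  have he' : ∀ t : ℕ, ∀ h : t < k, ((e' t : ℕ) : ℤ) = e ⟨t, h⟩ + S := by
    intro t h
    simp only [e', h, dif_pos]
    exact Int.toNat_of_nonneg (hS _).le
  obtain ⟨b, hb⟩ := IsLocalization.exist_integer_multiples (nonZeroDivisors R)
    (Finset.univ : Finset (Fin ℓ × Fin n)) (fun x => c x.1 x.2 * a x.2 ^ (-S))
  choose g hg using fun x => hb x (Finset.mem_univ x)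
  have hb0 : algebraMap R K b ≠ 0 := by
    intro h
    have := (IsFractionRing.injective R K) (h.trans (map_zero _).symm)
    exact nonZeroDivisors.ne_zero b.2 this
  have hg' : ∀ i j, algebraMap R K (g (i, j)) = algebraMap R K b * (c i j * a j ^ (-S)) := by
    intro i j
    have := hg (i, j)
    rw [Algebra.smul_def] at this
    exact this
  have key := gm_mds_core (F := F) e' k
    (by
      intro x y hxy hy
      have h1 := he' x (hxy.trans hy)
      have h2 := he' y hy
      have h3 := he (show (⟨x, hxy.trans hy⟩ : Fin k) < ⟨y, hy⟩ from hxy)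
      omega)
    (by
      intro x hx
      have h1 := he' x hx
      have := hS ⟨x, hx⟩
      omega)
    _ (Finset.univ : Finset (Fin ℓ)) B (fun _ => k) (fun i j => g (i, j)) le_rfl
    (fun _ _ => le_rfl) (fun i _ => hkB i)
    (by
      intro I _ hI
      obtain ⟨i, hi⟩ := hI
      refine ⟨i, hi, ?_⟩
      rw [Finset.sum_const, smul_eq_mul]
      exact hcond I ⟨i, hi⟩)
    (by
      intro i _ j hj
      apply IsFractionRing.injective R K
      rw [hg', hsupp i j hj, zero_mul, mul_zero, map_zero])
    (by
      intro i _ t ht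
      apply IsFractionRing.injective R K
      rw [map_sum, map_zero, ← mul_zero (algebraMap R K b), ← heq i ⟨t, ht⟩, Finset.mul_sum]
      refine Finset.sum_congr rfl fun j _ => ?_
      rw [map_mul, hg', map_pow]
      change _ * (_ * a j ^ (-S)) * a j ^ e' t = _ * (_ * a j ^ _)
      rw [← zpow_natCast, he' t ht, mul_assoc, mul_assoc, ← zpow_add₀ (ha j)]
      congr 3
      ring)
    (by
      intro j
      apply IsFractionRing.injective R K
      rw [map_sum, map_zero, Finset.sum_congr rfl (fun i _ => hg' i j), ← Finset.mul_sum,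
        ← Finset.sum_mul, hsum j, zero_mul, mul_zero])
  intro i j
  have h := key i (Finset.mem_univ i) j
  have h1 := hg' i j
  rw [h, map_zero] at h1
  have h2 := (mul_eq_zero.mp h1.symm).resolve_left hb0
  exact (mul_eq_zero.mp h2).resolve_right (zpow_ne_zero _ (ha j))

end GMMDS

section Final

lemma rank_ge_aux {F : Type*} [Field F] (k n : ℕ) (hkn : k ≤ n)
    (e : Fin k → ℤ) (he : StrictMono e)
    (V : Matrix (Fin k) (Fin n) (FractionRing (MvPolynomial (Fin n) F)))
    (hV : ∀ i j, V i j =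
      (algebraMap (MvPolynomial (Fin n) F) (FractionRing (MvPolynomial (Fin n) F))
        (MvPolynomial.X j)) ^ (e i)) : k ≤ V.rank := by
  classical
  let K := FractionRing (MvPolynomial (Fin n) F)
  let L : (Fin k → K) →ₗ[K] (Fin n → K) := Function.ExtendByZero.linearMap K (Fin.castLE hkn)
  have hcinj : Function.Injective (Fin.castLE hkn) := Fin.castLE_injective hkn
  have hL1 : ∀ x i, L x (Fin.castLE hkn i) = x i := fun x i => hcinj.extend_apply _ _ _
  have hL2 : ∀ x j, (¬ ∃ i, Fin.castLE hkn i = j) → L x j = 0 := fun x j h =>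
    Function.extend_apply' _ _ _ h
  have hinj : Function.Injective (V.mulVecLin ∘ₗ L) := by
    rw [← LinearMap.ker_eq_bot, LinearMap.ker_eq_bot']
    intro x hx
    let B : Finset (Fin n) := Finset.univ.map (Fin.castLEEmb hkn)
    have hBc : B.card = k := by simp [B]
    have key := gm_mds_frac (F := F) (k := k) (n := n) (ℓ := 2) e he (fun _ => B)
      (![L x, -L x]) (fun _ => hBc.ge) ?_ ?_ ?_ ?_
    · funext i
      have := key 0 (Fin.castLE hkn i)
      simpa [hL1] using this
    · intro I hI
      obtain ⟨i, hi⟩ := hI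
      have h1 := Finset.card_le_card
        (Finset.subset_biUnion_of_mem (fun _ : Fin 2 => B) hi)
      rw [Finset.sum_const, smul_eq_mul, hBc]
      rw [hBc] at h1
      omega
    · intro i j hj
      have h0 : L x j = 0 := by
        apply hL2
        rintro ⟨a, rfl⟩
        apply hj
        exact Finset.mem_map.mpr ⟨a, Finset.mem_univ _, rfl⟩
      fin_cases i <;> simp [h0]
    · intro i t
      have h0 : ∑ j, L x j * V t j = 0 := by
        have := congrFun hx t
        simpa [Matrix.mulVec, dotProduct, mul_comm] using this
      simp only [hV] at h0
      fin_cases i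
      · simpa using h0
      · simpa using h0
    · intro j
      simp
  have hsurj : Function.Surjective V.mulVecLin := by
    have h := LinearMap.injective_iff_surjective.mp hinj
    rw [LinearMap.coe_comp] at h
    exact h.of_comp
  rw [Matrix.rank, LinearMap.range_eq_top.mpr hsurj, finrank_top]
  simp

lemma inf_zero_aux {K : Type*} [Field K] {m n ℓ : ℕ} (Q : Matrix (Fin m) (Fin n) K)
    (A : Fin ℓ → Finset (Fin n))
    (hind : ∀ u : Fin ℓ → Fin m → K, (∀ i, ∀ j ∈ A i, ∑ r, u i r * Q r j = 0) →
      ∑ i, u i = 0 → ∀ i, u i = 0)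
    (hsum : ∑ i, (A i).card = (ℓ - 1) * m) (hℓ : 2 ≤ ℓ) :
    (⨅ i, colSpan Q (A i)) = ⊥ := by
  classical
  let T : ∀ i, (Fin m → K) →ₗ[K] (A i → K) := fun i =>
    { toFun := fun u j => ∑ r, u r * Q r j
      map_add' := by
        intro u v; funext j
        simp [add_mul, Finset.sum_add_distrib]
      map_smul' := by
        intro a u; funext j
        simp [Finset.mul_sum, mul_assoc] }
  have hker : ∀ i (u : LinearMap.ker (T i)), ∀ j ∈ A i, ∑ r, u.1 r * Q r j = 0 := by
    intro i u j hj
    exact congrFun (LinearMap.mem_ker.mp u.2) ⟨j, hj⟩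
  have hdim : ∀ i, m ≤ Module.finrank K (LinearMap.ker (T i)) + (A i).card := by
    intro i
    have h1 := LinearMap.finrank_range_add_finrank_ker (T i)
    have h2 := Submodule.finrank_le (LinearMap.range (T i))
    simp only [Module.finrank_fintype_fun_eq_card, Fintype.card_fin, Fintype.card_coe] at h1 h2
    omega
  let S : (∀ i, LinearMap.ker (T i)) →ₗ[K] (Fin m → K) :=
    ∑ i, (LinearMap.ker (T i)).subtype ∘ₗ LinearMap.proj i
  have hS : ∀ u, S u = ∑ i, (u i).1 := by
    intro u; simp [S]
  have hSinj : Function.Injective S := by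
    rw [← LinearMap.ker_eq_bot, LinearMap.ker_eq_bot']
    intro u hu
    rw [hS] at hu
    have := hind (fun i => (u i).1) (fun i => hker i (u i)) hu
    funext i
    exact Subtype.ext (this i)
  have hSdim : m ≤ Module.finrank K (∀ i, LinearMap.ker (T i)) := by
    rw [Module.finrank_pi_fintype]
    have h1 : ∑ _i : Fin ℓ, m ≤
        ∑ i, (Module.finrank K (LinearMap.ker (T i)) + (A i).card) :=
      Finset.sum_le_sum fun i _ => hdim i
    rw [Finset.sum_add_distrib, hsum, Finset.sum_const, Finset.card_univ, Fintype.card_fin,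
      smul_eq_mul] at h1
    obtain ⟨p, rfl⟩ : ∃ p, ℓ = p + 1 := ⟨ℓ - 1, by omega⟩
    rw [Nat.add_sub_cancel, add_mul, one_mul] at h1
    omega
  have hSsurj : LinearMap.range S = ⊤ := by
    apply Submodule.eq_top_of_finrank_eq
    rw [LinearMap.finrank_range_of_inj hSinj]
    have h2 := LinearMap.finrank_le_finrank_of_injective hSinj
    rw [Module.finrank_fintype_fun_eq_card, Fintype.card_fin] at *
    omega
  rw [eq_bot_iff]
  intro w hw
  rw [Submodule.mem_iInf] at hw
  have hort : ∀ i (u : LinearMap.ker (T i)), ∑ r, u.1 r * w r = 0 := by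
    intro i u
    refine Submodule.span_induction (p := fun w _ => ∑ r, u.1 r * w r = 0) ?_ ?_ ?_ ?_ (hw i)
    · rintro _ ⟨j, hj, rfl⟩
      exact hker i u j hj
    · simp
    · intro x y _ _ hx hy
      simp only [Pi.add_apply, mul_add, Finset.sum_add_distrib, hx, hy, add_zero]
    · intro a x _ hx
      simp only [Pi.smul_apply, smul_eq_mul, mul_left_comm _ a, ← Finset.mul_sum, hx, mul_zero]
  rw [Submodule.mem_bot]
  funext r0
  have hmem : (Pi.single r0 1 : Fin m → K) ∈ LinearMap.range S := by rw [hSsurj]; trivial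
  obtain ⟨u, hu⟩ := hmem
  rw [hS] at hu
  have h1 : ∑ r, (Pi.single r0 1 : Fin m → K) r * w r = 0 := by
    rw [← hu]
    simp only [Finset.sum_apply, Finset.sum_mul]
    rw [Finset.sum_comm]
    exact Finset.sum_eq_zero fun i _ => hort i (u i)
  simpa [Pi.single_apply] using h1

lemma cond_aux {k n ℓ : ℕ} (hkn : k ≤ n) (A : Fin ℓ → Finset (Fin n))
    (hA : ∀ i, (A i).card ≤ n - k)
    (hsum : ∑ i, (A i).card = (ℓ - 1) * (n - k)) (hnull : NullInter (n - k) A) (hℓ : 2 ≤ ℓ)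
    (I : Finset (Fin ℓ)) (hI : I.Nonempty) :
    ∑ i ∈ I, ((A i)ᶜ).card + k ≤ (I.biUnion fun i => (A i)ᶜ).card + I.card * k := by
  classical
  have hnotmem : I ∉ (Iᶜ).map ⟨fun i => ({i} : Finset (Fin ℓ)), Finset.singleton_injective⟩ := by
    intro h
    obtain ⟨i, hi, h⟩ := Finset.mem_map.mp h
    have h' : ({i} : Finset (Fin ℓ)) = I := h
    rw [← h'] at hi
    simp at hi
  let P : Finpartition (Finset.univ : Finset (Fin ℓ)) :=
    Finpartition.ofExistsUnique
      (insert I ((Iᶜ).map ⟨fun i => ({i} : Finset (Fin ℓ)), Finset.singleton_injective⟩))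
      (fun p _ => Finset.subset_univ p)
      (by
        intro a _
        by_cases ha : a ∈ I
        · refine ⟨I, ⟨Finset.mem_insert_self _ _, ha⟩, ?_⟩
          rintro t ⟨ht, hat⟩
          rcases Finset.mem_insert.mp ht with h | h
          · exact h
          · obtain ⟨i, hi, rfl⟩ := Finset.mem_map.mp h
            have : a = i := by simpa using hat
            subst this
            simp [ha] at hi
        · refine ⟨{a}, ⟨Finset.mem_insert_of_mem (Finset.mem_map.mpr ⟨a, by simpa using ha, rfl⟩),
            by simp⟩, ?_⟩
          rintro t ⟨ht, hat⟩
          rcases Finset.mem_insert.mp ht with h | h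
          · exact absurd (h ▸ hat) ha
          · obtain ⟨i, hi, rfl⟩ := Finset.mem_map.mp h
            have : a = i := by simpa using hat
            subst this
            rfl)
      (by
        intro h
        rcases Finset.mem_insert.mp h with h | h
        · exact hI.ne_empty h.symm
        · obtain ⟨i, hi, h⟩ := Finset.mem_map.mp h
          exact Finset.singleton_ne_empty i h)
  have h := hnull P
  have hP : P.parts =
      insert I ((Iᶜ).map ⟨fun i => ({i} : Finset (Fin ℓ)), Finset.singleton_injective⟩) := rfl
  rw [hP, Finset.sum_insert hnotmem, Finset.card_insert_of_notMem hnotmem, Finset.card_map,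
    Finset.sum_map, Nat.add_sub_cancel] at h
  have hsing : ∀ i, interSet A ({i} : Finset (Fin ℓ)) = A i := by
    intro i; ext x; simp [interSet]
  simp only [Function.Embedding.coeFn_mk, hsing] at h
  have hU : (I.biUnion fun i => (A i)ᶜ) = (interSet A I)ᶜ := by
    ext x; simp [interSet]
  have hUc : (I.biUnion fun i => (A i)ᶜ).card + (interSet A I).card = n := by
    rw [hU]
    simpa using Finset.card_compl_add_card (interSet A I)
  have hcs : ∑ i ∈ I, ((A i)ᶜ).card + ∑ i ∈ I, (A i).card = I.card * n := by
    rw [← Finset.sum_add_distrib, Finset.sum_congr rfl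
      (fun i _ => show ((A i)ᶜ).card + (A i).card = n by
        simpa using Finset.card_compl_add_card (A i)), Finset.sum_const, smul_eq_mul]
  have hsplit := Finset.sum_add_sum_compl I (fun i => (A i).card)
  rw [hsum] at hsplit
  have hIc : I.card + (Iᶜ).card = ℓ := by
    simpa using Finset.card_add_card_compl I
  obtain ⟨m, rfl⟩ : ∃ m, n = k + m := ⟨n - k, by omega⟩
  obtain ⟨p, hp⟩ : ∃ p, I.card = p + 1 :=
    ⟨I.card - 1, by have := Finset.card_pos.mpr hI; omega⟩
  have hl : ℓ - 1 = p + (Iᶜ).card := by omega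
  rw [Nat.add_sub_cancel_left] at h hsplit
  rw [hl, add_mul] at hsplit
  rw [hp] at hcs ⊢
  have e1 : (p + 1) * (k + m) = p * k + k + p * m + m := by ring
  have e2 : (p + 1) * k = p * k + k := by ring
  rw [e1] at hcs
  rw [e2]
  omega

end Final

/-- Generic monomial codes are `LD-MDS(≤ L)` for all `L`: duals of generic monomial
codes are `MDS(ℓ)` for all `ℓ ≥ 2`. -/
theorem generic_monomial_codes_LD_MDS
    (F : Type*) [Field F] (k n : ℕ) (hk : 1 ≤ k) (hkn : k ≤ n)
    (e : Fin k → ℤ) (he : StrictMono e)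
    (V : Matrix (Fin k) (Fin n) (FractionRing (MvPolynomial (Fin n) F)))
    (hV : ∀ i j, V i j =
      (algebraMap (MvPolynomial (Fin n) F) (FractionRing (MvPolynomial (Fin n) F))
        (MvPolynomial.X j)) ^ (e i)) :
    V.rank = k ∧
    ∀ Q : Matrix (Fin (n - k)) (Fin n) (FractionRing (MvPolynomial (Fin n) F)),
      Q.rank = n - k → V * Qᵀ = 0 →
      ∀ ℓ : ℕ, 2 ≤ ℓ → ∀ A : Fin ℓ → Finset (Fin n),
        (∀ i, (A i).card ≤ n - k) →
        (∑ i, (A i).card) = (ℓ - 1) * (n - k) →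
        NullInter (n - k) A →
        (⨅ i, colSpan Q (A i)) = ⊥ := by
  classical
  refine ⟨le_antisymm ?_ ?_, ?_⟩
  · simpa using V.rank_le_height
  · exact rank_ge_aux k n hkn e he V hV
  intro Q hQ hVQ ℓ hℓ A hA hAsum hnull
  -- injectivity of `u ↦ u ᵥ* Q`
  have hQinj : ∀ u : Fin (n - k) → FractionRing (MvPolynomial (Fin n) F),
      (∀ j, ∑ r, u r * Q r j = 0) → u = 0 := by
    have hli : LinearIndependent (FractionRing (MvPolynomial (Fin n) F)) Q.row := by
      rw [linearIndependent_iff_card_eq_finrank_span, Fintype.card_fin]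
      exact hQ.symm.trans Q.rank_eq_finrank_span_row
    intro u hu
    have := Matrix.vecMul_injective_iff.mpr hli
    apply this
    change Matrix.vecMul u Q = Matrix.vecMul 0 Q
    rw [Matrix.zero_vecMul]
    funext j
    simpa [Matrix.vecMul, dotProduct] using hu j
  refine inf_zero_aux Q A ?_ hAsum hℓ
  intro u hu hsum
  have key := gm_mds_frac (F := F) (k := k) (n := n) (ℓ := ℓ) e he (fun i => (A i)ᶜ)
    (fun i j => ∑ r, u i r * Q r j) ?_ ?_ ?_ ?_ ?_
  · intro i
    exact hQinj _ (key i)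
  · intro i
    have := hA i
    rw [Finset.card_compl, Fintype.card_fin]
    omega
  · intro I hI
    exact cond_aux hkn A hA hAsum hnull hℓ I hI
  · intro i j hj
    exact hu i j (by simpa using hj)
  · intro i t
    have h1 : ∀ r, ∑ j, V t j * Q r j = 0 := by
      intro r
      have := congrFun (congrFun hVQ t) r
      simpa [Matrix.mul_apply] using this
    calc _ = ∑ j, ∑ r, u i r * (V t j * Q r j) := by
          refine Finset.sum_congr rfl fun j _ => ?_
          rw [← hV, Finset.sum_mul]
          exact Finset.sum_congr rfl fun r _ => by ring
      _ = ∑ r, u i r * ∑ j, V t j * Q r j := by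
          rw [Finset.sum_comm]
          exact Finset.sum_congr rfl fun r _ => by rw [Finset.mul_sum]
      _ = 0 := Finset.sum_eq_zero fun r _ => by rw [h1, mul_zero]
  · intro j
    rw [Finset.sum_comm]
    refine Finset.sum_eq_zero fun r _ => ?_
    rw [← Finset.sum_mul]
    have := congrFun hsum r
    rw [Finset.sum_apply] at this
    rw [this, Pi.zero_apply, zero_mul]
end
end

section
/- Let F be a field, let 1 ≤ k ≤ n, let e : Fin k → ℤ be strictly monotone, let K := FractionField (MvPolynomial (Fin n) F), let α_j ∈ K be the image of the variable X_j, and let V ∈ K^{k×n} be the generic monomial matrix V_{i,j} := α_j^{e_i}. For σ ∈ {0,…,k} let R_{≤σ} ⊆ K^n denote the span of the first σ rows of V (equivalently, the first σ columns of Vᵀ), and for A ⊆ {1,…,n} let E_A ⊆ K^n denote the span of the standard basis vectors indexed by A. Then for every ℓ ≥ 1, every σ_1,…,σ_ℓ ∈ {0,…,k} and every A_1,…,A_ℓ ⊆ {1,…,n} with σ_i + |A_i| ≤ n for all i, the dimension over K of ⋂_{i=1}^ℓ (R_{≤σ_i} + E_{A_i}) equals gid_n((σ_i, A_i)_{i=1..ℓ})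 = max over all partitions of {1,…,ℓ} into nonempty parts P_1,…,P_s of (−n(s−1) + Σ_{i=1}^s (min_{j∈P_i} σ_j + |⋂_{j∈P_i} A_j|)). (In other words, the pair (Vᵀ, I_n) is a higher order MDS code with a basis, MDSb(ℓ), for all ℓ ≥ 1.) -/
open Finset Matrix

noncomputable section

/-- Divide a finite family, not all zero, by the largest common power of `x`. -/
lemma exists_reduce {R : Type*} [CommRing R] [IsDomain R] [WfDvdMonoid R] (x : R)
    (hx : ¬ IsUnit x) {κ : Type*} (T : Finset κ) (z : κ → R) (hz : ∃ a ∈ T, z a ≠ 0) :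
    ∃ (m : ℕ) (u : κ → R), (∀ a ∈ T, z a = x ^ m * u a) ∧ ∃ a ∈ T, ¬ x ∣ u a := by
  classical
  obtain ⟨a, ha, hza⟩ := hz
  have hex : ∃ m : ℕ, ∃ a ∈ T, ¬ x ^ m ∣ z a := by
    obtain ⟨m, hm⟩ := FiniteMultiplicity.of_not_isUnit hx hza
    exact ⟨m + 1, a, ha, hm⟩
  set m := Nat.find hex with hm
  have h1 := Nat.find_spec hex
  rw [← hm] at h1
  have hm0 : m ≠ 0 := by
    intro h
    rw [h] at h1
    simp at h1
  have h2 : ∀ a ∈ T, x ^ (m - 1) ∣ z a := by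
    have := Nat.find_min hex (m := m - 1) (by omega)
    push Not at this
    exact this
  choose! u hu using h2
  refine ⟨m - 1, u, hu, ?_⟩
  obtain ⟨b, hb, hnb⟩ := h1
  refine ⟨b, hb, fun h => hnb ?_⟩
  obtain ⟨c, hc⟩ := h
  refine ⟨c, ?_⟩
  rw [hu b hb, hc, ← mul_assoc, ← pow_succ]
  congr 2
  omega

/-- The specialization `X_{j0} ↦ 0`. -/
def specZero (F : Type*) [Field F] {J : Type*} [DecidableEq J] (j0 : J) :
    MvPolynomial J F →ₐ[F] MvPolynomial J F :=
  MvPolynomial.aeval (fun j => if j = j0 then 0 else MvPolynomial.X j)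

lemma specZero_X_self (F : Type*) [Field F] {J : Type*} [DecidableEq J] (j0 : J) :
    specZero F j0 (MvPolynomial.X j0) = 0 := by
  simp [specZero]

lemma specZero_X_ne (F : Type*) [Field F] {J : Type*} [DecidableEq J] {j0 j : J} (h : j ≠ j0) :
    specZero F j0 (MvPolynomial.X j) = MvPolynomial.X j := by
  simp [specZero, h]

lemma specZero_sub_dvd (F : Type*) [Field F] {J : Type*} [DecidableEq J] (j0 : J)
    (p : MvPolynomial J F) : (MvPolynomial.X j0 : MvPolynomial J F) ∣ p - specZero F j0 p := by
  induction p using MvPolynomial.induction_on with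
  | C a => simp [specZero]
  | add p q hp hq =>
    have := dvd_add hp hq
    rw [map_add]
    convert this using 1
    ring
  | mul_X p j hp =>
    rw [map_mul]
    by_cases h : j = j0
    · subst h
      rw [specZero_X_self]
      simp
    · rw [specZero_X_ne F h, ← sub_mul]
      exact Dvd.dvd.mul_right hp _

lemma X_not_isUnit (F : Type*) [Field F] {J : Type*} [DecidableEq J] (j0 : J) :
    ¬ IsUnit (MvPolynomial.X j0 : MvPolynomial J F) := by
  intro h
  have := h.map (specZero F j0)
  rw [specZero_X_self] at this
  exact not_isUnit_zero this

/-- Specialization lemma at the level of polynomials. -/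
lemma spec_poly (F : Type*) [Field F] {J : Type*} [DecidableEq J] [Fintype J] (j0 : J)
    {ι : Type*} (s : Finset ι) (σ : ι → ℕ) (B : ι → Finset J) (d : ℕ → ℕ) (k : ℕ)
    (hd : ∀ a b, a < b → b < k → d b < d a) (hσ : ∀ i ∈ s, σ i ≤ k)
    (v : ι → J → MvPolynomial J F)
    (hvB : ∀ i ∈ s, ∀ j, j ∉ B i → v i j = 0)
    (hv : ∀ i ∈ s, ∀ t, t < σ i → ∑ j, v i j * MvPolynomial.X j ^ d t = 0)
    (hne : ∃ i ∈ s, ∃ j, v i j ≠ 0) :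
    ∃ u : ι → J → MvPolynomial J F,
      (∃ i ∈ s, ∃ j, u i j ≠ 0) ∧
      (∀ i ∈ s, ∀ j, j ∉ B i → u i j = 0) ∧
      (∀ i ∈ s, 1 ≤ σ i → u i j0 = 0) ∧
      (∀ i ∈ s, ∀ t, (t + 1 < σ i ∨ (j0 ∉ B i ∧ t < σ i)) →
        ∑ j, u i j * MvPolynomial.X j ^ d t = 0) ∧
      ((∀ j, ∑ i ∈ s, v i j = 0) → ∀ j, ∑ i ∈ s, u i j = 0) := by
  classical
  set x : MvPolynomial J F := MvPolynomial.X j0 with hx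
  have hx0 : x ≠ 0 := MvPolynomial.X_ne_zero j0
  set c := d 0 + 1 with hc
  have hdc : ∀ t, t < k → d t < c := by
    intro t ht
    rcases Nat.eq_zero_or_pos t with h | h
    · subst h; omega
    · have := hd 0 t h ht
      omega
  set z : ι × J → MvPolynomial J F := fun a => if a.2 = j0 then v a.1 a.2 * x ^ c else v a.1 a.2
    with hz
  obtain ⟨m, u, hu, hund⟩ := exists_reduce x (X_not_isUnit F j0) (s ×ˢ Finset.univ) z (by
    obtain ⟨i, hi, j, hj⟩ := hne
    refine ⟨(i, j), by simp [hi], ?_⟩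
    simp only [hz]
    split_ifs
    · exact mul_ne_zero hj (pow_ne_zero _ hx0)
    · exact hj)
  have hu' : ∀ i ∈ s, ∀ j, z (i, j) = x ^ m * u (i, j) := fun i hi j => hu (i, j) (by simp [hi])
  have hxm : x ^ m ≠ 0 := pow_ne_zero _ hx0
  have huB : ∀ i ∈ s, ∀ j, j ∉ B i → u (i, j) = 0 := by
    intro i hi j hj
    have h := hu' i hi j
    simp only [hz, hvB i hi j hj, zero_mul, ite_self] at h
    rcases mul_eq_zero.mp h.symm with h | h
    · exact absurd h hxm
    · exact h
  -- the key relation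
  set S : ι → ℕ → MvPolynomial J F :=
    fun i t => ∑ j ∈ Finset.univ.erase j0, u (i, j) * MvPolynomial.X j ^ d t with hS
  have key : ∀ i ∈ s, ∀ t, t < σ i → x ^ (c - d t) * S i t + u (i, j0) = 0 := by
    intro i hi t ht
    have h := hv i hi t ht
    rw [← Finset.add_sum_erase _ _ (Finset.mem_univ j0)] at h
    have h1 : x ^ m * (x ^ (c - d t) * S i t + u (i, j0)) = 0 := by
      have e1 : x ^ m * u (i, j0) = v i j0 * x ^ c := by
        rw [← hu' i hi j0]; simp [hz]
      have e2 : x ^ m * S i t = ∑ j ∈ Finset.univ.erase j0, v i j * MvPolynomial.X j ^ d t := by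
        simp only [hS]
        rw [Finset.mul_sum]
        refine Finset.sum_congr rfl fun j hj => ?_
        rw [← mul_assoc, ← hu' i hi j]
        simp [hz, Finset.ne_of_mem_erase hj]
      have e3 : x ^ c = x ^ (c - d t) * x ^ d t := by
        rw [← pow_add]
        congr 1
        have := hdc t (by have := hσ i hi; omega)
        omega
      calc x ^ m * (x ^ (c - d t) * S i t + u (i, j0))
          = x ^ (c - d t) * (x ^ m * S i t) + x ^ m * u (i, j0) := by ring
        _ = x ^ (c - d t) * (v i j0 * x ^ d t +
              ∑ j ∈ Finset.univ.erase j0, v i j * MvPolynomial.X j ^ d t) := by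
            rw [e1, e2, e3]; ring
        _ = 0 := by rw [h, mul_zero]
    rcases mul_eq_zero.mp h1 with h | h
    · exact absurd h hxm
    · exact h
  have hφx : ∀ a : ℕ, 0 < a → specZero F j0 (x ^ a) = 0 := by
    intro a ha
    rw [map_pow, hx, specZero_X_self, zero_pow (by omega)]
  have huj0 : ∀ i ∈ s, 1 ≤ σ i → specZero F j0 (u (i, j0)) = 0 := by
    intro i hi h1
    have h := congrArg (specZero F j0) (key i hi (σ i - 1) (by omega))
    have hlt := hdc (σ i - 1) (by have := hσ i hi; omega)
    rw [map_add, map_mul, hφx _ (by omega)] at h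
    simpa using h
  have hφS : ∀ i t, specZero F j0 (S i t) =
      ∑ j ∈ Finset.univ.erase j0, specZero F j0 (u (i, j)) * MvPolynomial.X j ^ d t := by
    intro i t
    simp only [hS, map_sum, map_mul, map_pow]
    refine Finset.sum_congr rfl fun j hj => ?_
    rw [specZero_X_ne F (Finset.ne_of_mem_erase hj)]
  refine ⟨fun i j => specZero F j0 (u (i, j)), ?_, ?_, huj0, ?_, ?_⟩
  · obtain ⟨⟨i, j⟩, ha, hnd⟩ := hund
    refine ⟨i, (Finset.mem_product.mp ha).1, j, fun h => hnd ?_⟩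
    have h1 := specZero_sub_dvd F j0 (u (i, j))
    have h2 : specZero F j0 (u (i, j)) = 0 := h
    rw [h2, sub_zero] at h1
    exact h1
  · intro i hi j hj
    simp only [huB i hi j hj, map_zero]
  · intro i hi t ht
    have htσ : t < σ i := by omega
    rw [← Finset.add_sum_erase _ _ (Finset.mem_univ j0), ← hφS]
    simp only [huj0 i hi (by omega), zero_mul, zero_add]
    rcases ht with ht | ⟨hB, ht⟩
    · have k1 := key i hi t htσ
      have k2 := key i hi (σ i - 1) (by omega)
      have hk := hσ i hi
      have l1 := hd t (σ i - 1) (by omega) (by omega)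
      have l2 := hdc t (by omega)
      have e3 : x ^ (c - d (σ i - 1)) = x ^ (c - d t) * x ^ (d t - d (σ i - 1)) := by
        rw [← pow_add]
        congr 1
        omega
      have h3 : x ^ (c - d t) * (S i t - x ^ (d t - d (σ i - 1)) * S i (σ i - 1)) = 0 := by
        rw [e3] at k2
        linear_combination k1 - k2
      rcases mul_eq_zero.mp h3 with h | h
      · exact absurd h (pow_ne_zero _ hx0)
      · rw [sub_eq_zero.mp h, map_mul, hφx _ (by omega), zero_mul]
    · have k1 := key i hi t htσ
      rw [huB i hi j0 hB, add_zero] at k1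
      rcases mul_eq_zero.mp k1 with h | h
      · exact absurd h (pow_ne_zero _ hx0)
      · rw [h, map_zero]
  · intro hsum j
    rw [← map_sum]
    have : x ^ m * ∑ i ∈ s, u (i, j) = 0 := by
      rw [Finset.mul_sum, ← Finset.sum_congr rfl (fun i hi => hu' i hi j)]
      simp only [hz]
      split_ifs
      · rw [← Finset.sum_mul, hsum, zero_mul]
      · exact hsum j
    rcases mul_eq_zero.mp this with h | h
    · exact absurd h hxm
    · rw [h, map_zero]

/-- The homomorphism `X_j ↦ X_j⁻¹`. -/
lemma inv_hom_exists (F : Type*) [Field F] {J : Type*} [Fintype J] :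
    ∃ g : MvPolynomial J F →+* FractionRing (MvPolynomial J F), Function.Injective g ∧
      (∀ j, g (MvPolynomial.X j) = (algebraMap (MvPolynomial J F) (FractionRing (MvPolynomial J F))
        (MvPolynomial.X j))⁻¹) ∧
      ∀ {κ : Type} (T : Finset κ) (f : κ → FractionRing (MvPolynomial J F)),
        ∃ b : FractionRing (MvPolynomial J F), b ≠ 0 ∧ ∀ a ∈ T, ∃ r, b * f a = g r := by
  classical
  set R := MvPolynomial J F with hR
  set K := FractionRing R with hK
  set al := algebraMap R K with hal
  have hal_inj : Function.Injective al := IsFractionRing.injective R K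
  have hXne : ∀ j, al (MvPolynomial.X j) ≠ 0 := fun j h =>
    MvPolynomial.X_ne_zero j (hal_inj (by rw [h, map_zero]))
  set g : R →+* K := MvPolynomial.eval₂Hom (al.comp MvPolynomial.C)
    (fun j => (al (MvPolynomial.X j))⁻¹) with hg
  have hgX : ∀ j, g (MvPolynomial.X j) = (al (MvPolynomial.X j))⁻¹ := fun j => MvPolynomial.eval₂_X _ _ _
  have hgC : ∀ a, g (MvPolynomial.C a) = al (MvPolynomial.C a) := fun a => MvPolynomial.eval₂_C _ _ _
  have hginj : Function.Injective g := by
    obtain ⟨x, hx⟩ : ∃ x : R, x = ∏ j, MvPolynomial.X j := ⟨_, rfl⟩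
    let S := Localization.Away x
    have hxle : Submonoid.powers x ≤ nonZeroDivisors R := by
      rw [Submonoid.powers_le, hx]
      exact mem_nonZeroDivisors_of_ne_zero
        (Finset.prod_ne_zero_iff.mpr fun j _ => MvPolynomial.X_ne_zero j)
    have hRS : Function.Injective (algebraMap R S) := IsLocalization.injective S hxle
    have hunit : ∀ j, IsUnit (algebraMap R S (MvPolynomial.X j)) := by
      intro j
      have h1 : IsUnit (algebraMap R S x) := IsLocalization.Away.algebraMap_isUnit x
      have hxx := congrArg (algebraMap R S) hx
      rw [map_prod] at hxx
      rw [hxx] at h1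
      exact isUnit_of_dvd_unit (Finset.dvd_prod_of_mem
        (fun j => algebraMap R S (MvPolynomial.X j)) (Finset.mem_univ j)) h1
    choose un hun using hunit
    set gS : R →+* S := MvPolynomial.eval₂Hom ((algebraMap R S).comp MvPolynomial.C)
      (fun j => ((un j)⁻¹ : Sˣ)) with hgS
    have hgSx : IsUnit (gS x) := by
      have : gS x = ((∏ j, (un j)⁻¹ : Sˣ) : S) := by
        have hxx := congrArg gS hx
        rw [map_prod] at hxx
        rw [hxx]
        push_cast
        exact Finset.prod_congr rfl fun j _ => MvPolynomial.eval₂_X _ _ _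
      rw [this]
      exact Units.isUnit _
    let θ : S →+* S := IsLocalization.Away.lift x hgSx
    have hθ : ∀ r, θ (algebraMap R S r) = gS r := fun r => IsLocalization.Away.lift_eq x hgSx r
    have hcomp : θ.comp gS = algebraMap R S := by
      refine MvPolynomial.ringHom_ext ?_ ?_
      · intro a
        have : gS (MvPolynomial.C a) = algebraMap R S (MvPolynomial.C a) := MvPolynomial.eval₂_C _ _ _
        rw [RingHom.comp_apply, this, hθ, this]
      · intro j
        have e1 : gS (MvPolynomial.X j) = (((un j)⁻¹ : Sˣ) : S) := MvPolynomial.eval₂_X _ _ _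
        rw [RingHom.comp_apply, e1]
        have e2 : θ (un j : S) = (((un j)⁻¹ : Sˣ) : S) := by rw [hun, hθ, e1]
        have e3 : θ (((un j)⁻¹ : Sˣ) : S) * θ (un j : S) = 1 := by
          rw [← map_mul, Units.inv_mul, map_one]
        rw [e2] at e3
        rw [← hun j]
        calc θ (((un j)⁻¹ : Sˣ) : S) = θ (((un j)⁻¹ : Sˣ) : S) * (((un j)⁻¹ : Sˣ) : S) * (un j) := by
              rw [mul_assoc, Units.inv_mul, mul_one]
          _ = un j := by rw [e3, one_mul]
    have hgS_inj : Function.Injective gS := by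
      have : Function.Injective (θ.comp gS) := by rw [hcomp]; exact hRS
      rw [RingHom.coe_comp] at this
      exact this.of_comp
    have hxK : IsUnit (al x) := by
      rw [isUnit_iff_ne_zero, hx, map_prod]
      exact Finset.prod_ne_zero_iff.mpr fun j _ => hXne j
    let τ : S →+* K := IsLocalization.Away.lift x hxK
    have hτ : ∀ r, τ (algebraMap R S r) = al r := fun r => IsLocalization.Away.lift_eq x hxK r
    have hτinj : Function.Injective τ := by
      rw [injective_iff_map_eq_zero]
      intro a ha
      obtain ⟨r, m, rfl⟩ := IsLocalization.exists_mk'_eq (Submonoid.powers x) a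
      have h1 : τ (IsLocalization.mk' S r m) * τ (algebraMap R S m) = al r := by
        rw [← map_mul, IsLocalization.mk'_spec, hτ]
      rw [ha, zero_mul] at h1
      have : r = 0 := hal_inj (by rw [← h1, map_zero])
      rw [this, IsLocalization.mk'_zero]
    have hgτ : g = τ.comp gS := by
      refine MvPolynomial.ringHom_ext ?_ ?_
      · intro a
        have : gS (MvPolynomial.C a) = algebraMap R S (MvPolynomial.C a) := MvPolynomial.eval₂_C _ _ _
        rw [RingHom.comp_apply, this, hτ, hgC]
      · intro j
        have e1 : gS (MvPolynomial.X j) = (((un j)⁻¹ : Sˣ) : S) := MvPolynomial.eval₂_X _ _ _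
        rw [RingHom.comp_apply, e1, hgX]
        refine inv_eq_of_mul_eq_one_left ?_
        rw [← hτ, ← hun, ← map_mul, Units.inv_mul, map_one]
    rw [hgτ, RingHom.coe_comp]
    exact hτinj.comp hgS_inj
  refine ⟨g, hginj, hgX, ?_⟩
  let ψ : K →+* K := IsFractionRing.lift hginj
  have hψ : ∀ r, ψ (al r) = g r := fun r => IsFractionRing.lift_algebraMap hginj r
  have hψg : ψ.comp g = al := by
    refine MvPolynomial.ringHom_ext ?_ ?_
    · intro a
      rw [RingHom.comp_apply, hgC, hψ, hgC]
    · intro j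
      rw [RingHom.comp_apply, hgX, map_inv₀, hψ, hgX, inv_inv]
  have hψψ : ∀ x, ψ (ψ x) = x := by
    intro x
    obtain ⟨a, b, _, rfl⟩ := IsFractionRing.div_surjective (A := R) x
    have h2 : ∀ r, ψ (g r) = al r := fun r => by rw [← hψg]; rfl
    rw [map_div₀, map_div₀, hψ, hψ, h2, h2]
  intro κ T f
  obtain ⟨b, hb⟩ := IsLocalization.exist_integer_multiples (nonZeroDivisors R) T
    (fun a => ψ (f a))
  refine ⟨g b, ?_, ?_⟩
  · intro h
    have : (b : R) = 0 := hginj (by rw [h, map_zero])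
    exact nonZeroDivisors.coe_ne_zero b this
  · intro a ha
    obtain ⟨r, hr⟩ := hb a ha
    refine ⟨r, ?_⟩
    have := congrArg ψ hr
    rw [hψ, Algebra.smul_def, map_mul, hψ, hψψ] at this
    exact this.symm

/-- Relations supported on `B` among the columns, using the first `σ` rows of `M`. -/
def relSpace {K : Type*} [Field K] {J : Type*} [Fintype J] (M : ℕ → J → K) (σ : ℕ)
    (B : Finset J) : Submodule K (J → K) where
  carrier := {y | (∀ j, j ∉ B → y j = 0) ∧ ∀ t, t < σ → ∑ j, y j * M t j = 0}
  add_mem' := by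
    rintro a b ⟨ha, ha'⟩ ⟨hb, hb'⟩
    refine ⟨fun j hj => by simp [ha j hj, hb j hj], fun t ht => ?_⟩
    simp [add_mul, Finset.sum_add_distrib, ha' t ht, hb' t ht]
  zero_mem' := by simp
  smul_mem' := by
    rintro c a ⟨ha, ha'⟩
    refine ⟨fun j hj => by simp [ha j hj], fun t ht => ?_⟩
    simp [mul_assoc, ← Finset.mul_sum, ha' t ht]

lemma mem_relSpace {K : Type*} [Field K] {J : Type*} [Fintype J] {M : ℕ → J → K} {σ : ℕ}
    {B : Finset J} {y : J → K} :
    y ∈ relSpace M σ B ↔ (∀ j, j ∉ B → y j = 0) ∧ ∀ t, t < σ → ∑ j, y j * M t j = 0 := Iff.rfl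

/-- The specialization property. -/
def SpecProp {K : Type*} [Field K] {J : Type*} [Fintype J] (M : ℕ → J → K) : Prop :=
  ∀ (j0 : J) (ι : Type) (s : Finset ι) (σ : ι → ℕ) (B : ι → Finset J) (y : ι → J → K),
    (∀ i ∈ s, y i ∈ relSpace M (σ i) (B i)) → (∃ i ∈ s, y i ≠ 0) →
    ∃ u : ι → J → K, (∃ i ∈ s, u i ≠ 0) ∧
      (∀ i ∈ s, ∀ j, j ∉ B i → u i j = 0) ∧
      (∀ i ∈ s, 1 ≤ σ i → u i j0 = 0) ∧
      (∀ i ∈ s, ∀ t, (t + 1 < σ i ∨ (j0 ∉ B i ∧ t < σ i)) → ∑ j, u i j * M t j = 0) ∧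
      (∑ i ∈ s, y i = 0 → ∑ i ∈ s, u i = 0)

lemma specProp_generic (F : Type*) [Field F] {J : Type*} [Fintype J] [DecidableEq J]
    (e : ℕ → ℤ) (he : StrictMono e) :
    SpecProp (fun (t : ℕ) (j : J) => (algebraMap (MvPolynomial J F)
      (FractionRing (MvPolynomial J F)) (MvPolynomial.X j)) ^ (e t)) := by
  classical
  intro j0 ι s σ B y hy hne
  obtain ⟨g, hginj, hgX, hden⟩ := inv_hom_exists F (J := J)
  let K := FractionRing (MvPolynomial J F)
  set k := s.sup σ with hk
  have hσk : ∀ i ∈ s, σ i ≤ k := fun i hi => Finset.le_sup hi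
  obtain ⟨β, hβ⟩ : ∃ β : J → K, ∀ j, β j = g (MvPolynomial.X j) := ⟨_, fun _ => rfl⟩
  have hβ0 : ∀ j, β j ≠ 0 := fun j h => MvPolynomial.X_ne_zero j (hginj (by
    rw [← hβ, h, map_zero]))
  have hα : ∀ j (z : ℤ), (algebraMap (MvPolynomial J F) K (MvPolynomial.X j)) ^ z = β j ^ (-z) := by
    intro j z
    rw [hβ, hgX, _root_.inv_zpow, _root_.zpow_neg, inv_inv]
  have hrow : ∀ (t : ℕ) (y : J → K), (∑ j, y j * (algebraMap (MvPolynomial J F) K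
      (MvPolynomial.X j)) ^ (e t)) = ∑ j, y j * β j ^ (-(e t)) := fun t y => by simp only [hα]
  set d : ℕ → ℕ := fun t => (e k - e t).toNat with hd
  have hdt : ∀ t, t < k → ((d t : ℕ) : ℤ) = e k - e t := by
    intro t ht
    have := he ht
    simp only [hd]
    omega
  have hpow : ∀ t, t < k → ∀ j, β j ^ (-(e t)) = β j ^ (-(e k)) * β j ^ (d t) := by
    intro t ht j
    rw [← zpow_natCast, ← zpow_add₀ (hβ0 j), hdt t ht]
    congr 1
    ring
  obtain ⟨b, hb0, hb⟩ : ∃ b : K, b ≠ 0 ∧ ∀ i ∈ s, ∀ j, ∃ r, b * (y i j * β j ^ (-(e k))) = g r := by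
    obtain ⟨b, hb0, hb⟩ := hden (s ×ˢ (Finset.univ : Finset (Fin (Fintype.card J))))
      (fun a => y a.1 ((Fintype.equivFin J).symm a.2) * β ((Fintype.equivFin J).symm a.2) ^ (-(e k)))
    refine ⟨b, hb0, fun i hi j => ?_⟩
    have := hb (i, Fintype.equivFin J j) (by simp [hi])
    simpa using this
  choose! v hv using hb
  have hsum_iff : ∀ (u : J → MvPolynomial J F) t, t < k →
      g (∑ j, u j * MvPolynomial.X j ^ d t) = ∑ j, (g (u j) * β j ^ (e k)) * β j ^ (-(e t)) := by
    intro u t ht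
    rw [map_sum]
    refine Finset.sum_congr rfl fun j _ => ?_
    rw [map_mul, map_pow, ← hβ, hpow t ht, mul_assoc, ← mul_assoc (β j ^ (e k)),
      ← zpow_add₀ (hβ0 j)]
    simp
  have hgv : ∀ i ∈ s, ∀ j, g (v i j) * β j ^ (e k) = b * y i j := by
    intro i hi j
    rw [← hv i hi j, mul_assoc, mul_assoc, ← zpow_add₀ (hβ0 j)]
    simp
  have hgv0 : ∀ i ∈ s, ∀ j, v i j = 0 ↔ y i j = 0 := by
    intro i hi j
    rw [← map_eq_zero_iff g hginj, ← hv i hi j]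
    simp [hb0, zpow_ne_zero _ (hβ0 j)]
  obtain ⟨u, h1, h2, h3, h4, h5⟩ := spec_poly F j0 s σ B d k (by
      intro a c hac hck
      have e1 := hdt a (by omega)
      have e2 := hdt c hck
      have := he hac
      omega) hσk v (by
      intro i hi j hj
      rw [hgv0 i hi j]
      exact (hy i hi).1 j hj) (by
      intro i hi t ht
      apply hginj
      rw [hsum_iff _ t (by have := hσk i hi; omega), map_zero]
      have := (hy i hi).2 t ht
      rw [hrow] at this
      calc _ = ∑ j, b * (y i j * β j ^ (-(e t))) :=
            Finset.sum_congr rfl fun j _ => by rw [hgv i hi, mul_assoc]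
        _ = 0 := by rw [← Finset.mul_sum, this, mul_zero]) (by
      obtain ⟨i, hi, hne⟩ := hne
      obtain ⟨j, hj⟩ := Function.ne_iff.mp hne
      exact ⟨i, hi, j, fun h => hj ((hgv0 i hi j).mp h)⟩)
  refine ⟨fun i j => g (u i j) * β j ^ (e k), ?_, ?_, ?_, ?_, ?_⟩
  · obtain ⟨i, hi, j, hj⟩ := h1
    refine ⟨i, hi, Function.ne_iff.mpr ⟨j, ?_⟩⟩
    refine mul_ne_zero ?_ (zpow_ne_zero _ (hβ0 j))
    exact (map_ne_zero_iff g hginj).mpr hj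
  · intro i hi j hj
    simp only [h2 i hi j hj, map_zero, zero_mul]
  · intro i hi h
    simp only [h3 i hi h, map_zero, zero_mul]
  · intro i hi t ht
    rw [hrow, ← hsum_iff (u i) t (by have := hσk i hi; omega), h4 i hi t ht, map_zero]
  · intro hs
    have h6 : ∀ j, ∑ i ∈ s, v i j = 0 := by
      intro j
      apply hginj
      have hsj : ∑ i ∈ s, y i j = 0 := by
        have := congrFun hs j
        simpa using this
      rw [map_sum, map_zero]
      calc _ = ∑ i ∈ s, b * (y i j * β j ^ (-(e k))) :=
            Finset.sum_congr rfl fun i hi => (hv i hi j).symm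
        _ = 0 := by rw [← Finset.mul_sum, ← Finset.sum_mul, hsj, zero_mul, mul_zero]
    ext j
    simp only [Finset.sum_apply, Pi.zero_apply]
    rw [← Finset.sum_mul, ← map_sum, h5 h6 j, map_zero, zero_mul]

section dims

set_option linter.unusedSectionVars false

variable {K : Type*} [Field K] {J : Type*} [Fintype J] [DecidableEq J]

lemma relSpace_mono {M : ℕ → J → K} {σ σ' : ℕ} {B B' : Finset J} (hσ : σ' ≤ σ) (hB : B ⊆ B') :
    relSpace M σ B ≤ relSpace M σ' B' := by
  rintro y ⟨h1, h2⟩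
  exact ⟨fun j hj => h1 j fun h => hj (hB h), fun t ht => h2 t (by omega)⟩

/-- Cutting by a linear form drops the dimension by at most one. -/
lemma finrank_inf_ker (U : Submodule K (J → K)) (f : (J → K) →ₗ[K] K) :
    Module.finrank K U ≤ Module.finrank K ↥(U ⊓ LinearMap.ker f) + 1 := by
  have h := LinearMap.finrank_range_add_finrank_ker (f.domRestrict U)
  have h1 : Module.finrank K (LinearMap.range (f.domRestrict U)) ≤ 1 := by
    have := Submodule.finrank_le (LinearMap.range (f.domRestrict U))
    simpa using this
  have h2 : Module.finrank K (LinearMap.ker (f.domRestrict U)) ≤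
      Module.finrank K ↥(U ⊓ LinearMap.ker f) := by
    let g : LinearMap.ker (f.domRestrict U) →ₗ[K] ↥(U ⊓ LinearMap.ker f) :=
      { toFun := fun x => ⟨x.1.1, x.1.2, x.2⟩
        map_add' := fun _ _ => rfl
        map_smul' := fun _ _ => rfl }
    refine LinearMap.finrank_le_finrank_of_injective (f := g) ?_
    intro a b hab
    have := congrArg Subtype.val hab
    exact Subtype.ext (Subtype.ext this)
  omega

lemma finrank_relSpace_zero (M : ℕ → J → K) (B : Finset J) :
    B.card ≤ Module.finrank K (relSpace M 0 B) := by
  have hmem : ∀ x : B, (Pi.single x.1 (1 : K) : J → K) ∈ relSpace M 0 B := by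
    intro x
    refine ⟨fun j hj => ?_, fun t ht => by omega⟩
    refine Pi.single_eq_of_ne (fun h => hj ?_) _
    rw [h]
    exact x.2
  have hli : LinearIndependent K (fun x : B => (⟨_, hmem x⟩ : relSpace M 0 B)) := by
    refine LinearIndependent.of_comp (relSpace M 0 B).subtype ?_
    have := (Pi.basisFun K J).linearIndependent.comp (fun x : B => x.1) Subtype.val_injective
    convert this using 1
    ext x
    simp
  have := hli.fintype_card_le_finrank
  simpa using this

lemma finrank_relSpace_ge (M : ℕ → J → K) (σ : ℕ) (B : Finset J) :
    B.card ≤ Module.finrank K (relSpace M σ B) + σ := by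
  induction σ with
  | zero => simpa using finrank_relSpace_zero M B
  | succ σ ih =>
    have h := finrank_inf_ker (relSpace M σ B)
      (∑ j, (M σ j) • (LinearMap.proj j : (J → K) →ₗ[K] K))
    have hle : relSpace M σ B ⊓ LinearMap.ker (∑ j, (M σ j) • (LinearMap.proj j : (J → K) →ₗ[K] K))
        ≤ relSpace M (σ + 1) B := by
      rintro y ⟨⟨h1, h2⟩, h3⟩
      refine ⟨h1, fun t ht => ?_⟩
      rcases Nat.lt_succ_iff_lt_or_eq.mp ht with h | h
      · exact h2 t h
      · subst h
        simp only [SetLike.mem_coe, LinearMap.mem_ker, LinearMap.sum_apply, LinearMap.smul_apply, LinearMap.proj_apply,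
          smul_eq_mul] at h3
        simpa [mul_comm] using h3
    have := Submodule.finrank_mono hle
    omega

lemma relSpace_square_eq_bot {M : ℕ → J → K} (hM : SpecProp M) (σ : ℕ) :
    ∀ B : Finset J, B.card = σ → relSpace M σ B = ⊥ := by
  induction σ with
  | zero =>
    intro B hB
    rw [Finset.card_eq_zero] at hB
    subst hB
    rw [eq_bot_iff]
    rintro y ⟨h1, -⟩
    rw [Submodule.mem_bot]
    ext j
    exact h1 j (by simp)
  | succ σ ih =>
    intro B hB
    rw [eq_bot_iff]
    intro y hy
    rw [Submodule.mem_bot]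
    by_contra hne
    obtain ⟨j0, hj0⟩ : B.Nonempty := Finset.card_pos.mp (by omega)
    obtain ⟨u, h1, h2, h3, h4, -⟩ := hM j0 Unit {()} (fun _ => σ + 1) (fun _ => B) (fun _ => y)
      (fun _ _ => hy) ⟨(), by simp, hne⟩
    obtain ⟨i, hi, hu⟩ := h1
    apply hu
    have : u i ∈ relSpace M σ (B.erase j0) := by
      refine ⟨fun j hj => ?_, fun t ht => h4 i hi t (Or.inl (by omega))⟩
      by_cases hjj : j = j0
      · rw [hjj]
        exact h3 i hi (by omega)
      · exact h2 i hi j fun h => hj (Finset.mem_erase.mpr ⟨hjj, h⟩)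
    rw [ih (B.erase j0) (by rw [Finset.card_erase_of_mem hj0]; omega)] at this
    simpa using this

lemma finrank_relSpace {M : ℕ → J → K} (hM : SpecProp M) (σ : ℕ) (B : Finset J)
    (h : σ ≤ B.card) : Module.finrank K (relSpace M σ B) + σ = B.card := by
  refine le_antisymm ?_ (finrank_relSpace_ge M σ B)
  obtain ⟨c, hc⟩ := Nat.exists_eq_add_of_le h
  induction c generalizing B with
  | zero =>
    rw [relSpace_square_eq_bot hM σ B (by omega)]
    simp [hc]
  | succ c ih =>
    obtain ⟨j0, hj0⟩ : B.Nonempty := Finset.card_pos.mp (by omega)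
    have hcard := Finset.card_erase_of_mem hj0
    have h1 := ih (B.erase j0) (by omega) (by omega)
    have h2 := finrank_inf_ker (relSpace M σ B) (LinearMap.proj j0 : (J → K) →ₗ[K] K)
    have hle : relSpace M σ B ⊓ LinearMap.ker (LinearMap.proj j0 : (J → K) →ₗ[K] K)
        ≤ relSpace M σ (B.erase j0) := by
      rintro y ⟨⟨g1, g2⟩, g3⟩
      refine ⟨fun j hj => ?_, g2⟩
      by_cases hjj : j = j0
      · rw [hjj]
        exact g3
      · exact g1 j fun h => hj (Finset.mem_erase.mpr ⟨hjj, h⟩)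
    have := Submodule.finrank_mono hle
    omega

/-- dimension of a finite sum is at most the sum of dimensions -/
lemma finrank_biSup_le {ι : Type*} (s : Finset ι) (U : ι → Submodule K (J → K)) :
    Module.finrank K ↥(⨆ i ∈ s, U i) ≤ ∑ i ∈ s, Module.finrank K (U i) := by
  classical
  induction s using Finset.induction_on with
  | empty => simp
  | insert a s ha ih =>
    rw [Finset.iSup_insert, Finset.sum_insert ha]
    exact (Submodule.finrank_add_le_finrank_add_finrank _ _).trans (by omega)

/-- the sum map on a family of subspaces -/
def sumMap {ι : Type*} (s : Finset ι) (U : ι → Submodule K (J → K)) :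
    ((i : s) → U i) →ₗ[K] (J → K) :=
  ∑ i : s, (U i).subtype ∘ₗ LinearMap.proj i

lemma sumMap_apply {ι : Type*} (s : Finset ι) (U : ι → Submodule K (J → K)) (f : (i : s) → U i) :
    sumMap s U f = ∑ i : s, (f i : J → K) := by
  simp [sumMap]

lemma range_sumMap {ι : Type*} (s : Finset ι) (U : ι → Submodule K (J → K)) :
    LinearMap.range (sumMap s U) = ⨆ i ∈ s, U i := by
  classical
  ext y
  rw [Submodule.mem_iSup_finset_iff_exists_sum, LinearMap.mem_range]
  constructor
  · rintro ⟨f, rfl⟩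
    refine ⟨fun i => if h : i ∈ s then f ⟨i, h⟩ else 0, ?_⟩
    rw [sumMap_apply, ← Finset.sum_attach]
    refine Finset.sum_congr rfl fun i _ => ?_
    simp
  · rintro ⟨μ, rfl⟩
    refine ⟨fun i => μ i, ?_⟩
    rw [sumMap_apply, ← Finset.sum_attach s]
    rfl

lemma finrank_sumMap_dom {ι : Type*} (s : Finset ι) (U : ι → Submodule K (J → K)) :
    Module.finrank K ((i : s) → U i) = ∑ i ∈ s, Module.finrank K (U i) := by
  rw [Module.finrank_pi_fintype, ← Finset.sum_attach s]
  rfl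

/-- numerical independence from absence of relations -/
lemma ind_of_no_rel {ι : Type*} (s : Finset ι) (U : ι → Submodule K (J → K))
    (h : ∀ y : ι → J → K, (∀ i ∈ s, y i ∈ U i) → ∑ i ∈ s, y i = 0 → ∀ i ∈ s, y i = 0) :
    ∑ i ∈ s, Module.finrank K (U i) ≤ Module.finrank K ↥(⨆ i ∈ s, U i) := by
  classical
  have hk : LinearMap.ker (sumMap s U) = ⊥ := by
    rw [eq_bot_iff]
    intro f hf
    rw [LinearMap.mem_ker, sumMap_apply] at hf
    rw [Submodule.mem_bot]
    have := h (fun i => if h : i ∈ s then f ⟨i, h⟩ else 0) (by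
      intro i hi
      simp [hi]) (by
      rw [← hf, ← Finset.sum_attach]
      refine Finset.sum_congr rfl fun i _ => ?_
      simp)
    ext1 i
    have := this i.1 i.2
    simpa using this
  have := LinearMap.finrank_range_add_finrank_ker (sumMap s U)
  rw [hk, range_sumMap, finrank_sumMap_dom] at this
  simp at this
  omega

lemma no_rel_of_ind {ι : Type*} (s : Finset ι) (U : ι → Submodule K (J → K))
    (h : ∑ i ∈ s, Module.finrank K (U i) ≤ Module.finrank K ↥(⨆ i ∈ s, U i)) :
    ∀ y : ι → J → K, (∀ i ∈ s, y i ∈ U i) → ∑ i ∈ s, y i = 0 → ∀ i ∈ s, y i = 0 := by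
  classical
  intro y hy hsum i hi
  have h1 := LinearMap.finrank_range_add_finrank_ker (sumMap s U)
  rw [range_sumMap, finrank_sumMap_dom] at h1
  have hk : LinearMap.ker (sumMap s U) = ⊥ := by
    rw [← Submodule.finrank_eq_zero (R := K)]
    omega
  have hf : (fun i : s => (⟨y i, hy i i.2⟩ : U i)) ∈ LinearMap.ker (sumMap s U) := by
    rw [LinearMap.mem_ker, sumMap_apply, ← hsum, ← Finset.sum_attach s]
    rfl
  rw [hk, Submodule.mem_bot] at hf
  have := congrFun hf ⟨i, hi⟩
  exact congrArg Subtype.val this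

end dims

section comb

set_option linter.unusedSectionVars false

variable {K : Type*} [Field K] {J : Type*} [Fintype J] [DecidableEq J]

/-- minimum of `σ` over `q` -/
def smin {ι : Type*} (σ : ι → ℕ) (q : Finset ι) : ℕ := sInf (σ '' (q : Set ι))

lemma smin_le {ι : Type*} (σ : ι → ℕ) {q : Finset ι} {i : ι} (hi : i ∈ q) : smin σ q ≤ σ i :=
  Nat.sInf_le ⟨i, hi, rfl⟩

lemma smin_mem {ι : Type*} (σ : ι → ℕ) {q : Finset ι} (hq : q.Nonempty) :
    ∃ i ∈ q, σ i = smin σ q := by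
  have : smin σ q ∈ σ '' (q : Set ι) := Nat.sInf_mem (hq.to_set.image σ)
  exact this

lemma smin_singleton {ι : Type*} (σ : ι → ℕ) (i : ι) : smin σ {i} = σ i := by
  simp [smin]

/-- the closure of a set of indices -/
def bigSpace (M : ℕ → J → K) {ι : Type*} (σ : ι → ℕ) (B : ι → Finset J)
    (q : Finset ι) : Submodule K (J → K) :=
  relSpace M (smin σ q) (q.biUnion B)

lemma le_bigSpace (M : ℕ → J → K) {ι : Type*} (σ : ι → ℕ) (B : ι → Finset J)
    (q : Finset ι) : (⨆ i ∈ q, relSpace M (σ i) (B i)) ≤ bigSpace M σ B q :=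
  iSup₂_le fun _ hi => relSpace_mono (smin_le σ hi) (Finset.subset_biUnion_of_mem B hi)

lemma bigSpace_singleton (M : ℕ → J → K) {ι : Type*} (σ : ι → ℕ) (B : ι → Finset J)
    (i : ι) : bigSpace M σ B {i} = relSpace M (σ i) (B i) := by
  unfold bigSpace
  rw [smin_singleton, Finset.singleton_biUnion]

lemma smin_le_card {ι : Type*} {σ : ι → ℕ} {B : ι → Finset J}
    {q : Finset ι} (hq : q.Nonempty) (h : ∀ i ∈ q, σ i ≤ (B i).card) :
    smin σ q ≤ (q.biUnion B).card := by
  obtain ⟨i, hi⟩ := hq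
  exact (smin_le σ hi).trans ((h i hi).trans (Finset.card_le_card
    (Finset.subset_biUnion_of_mem B hi)))

lemma finrank_bigSpace {M : ℕ → J → K} (hM : SpecProp M) {ι : Type*} {σ : ι → ℕ}
    {B : ι → Finset J} {q : Finset ι} (hq : q.Nonempty) (h : ∀ i ∈ q, σ i ≤ (B i).card) :
    Module.finrank K (bigSpace M σ B q) + smin σ q = (q.biUnion B).card :=
  finrank_relSpace hM _ _ (smin_le_card hq h)

/-- numeric criterion for independence -/
def NStat (M : ℕ → J → K) (m : ℕ) : Prop :=
  ∀ (ι : Type) (s : Finset ι) (σ : ι → ℕ) (B : ι → Finset J),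
    (∀ i ∈ s, σ i ≤ (B i).card) → (s.biUnion B).card ≤ m →
    (∀ q ⊆ s, q.Nonempty → ∑ i ∈ q, Module.finrank K (relSpace M (σ i) (B i)) ≤
      Module.finrank K (bigSpace M σ B q)) →
    ∑ i ∈ s, Module.finrank K (relSpace M (σ i) (B i)) ≤
      Module.finrank K ↥(⨆ i ∈ s, relSpace M (σ i) (B i))

/-- independence when no subset of size at least two fills its closure -/
def LStat (M : ℕ → J → K) (m : ℕ) : Prop :=
  ∀ (ι : Type) (s : Finset ι) (σ : ι → ℕ) (B : ι → Finset J),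
    (∀ i ∈ s, σ i ≤ (B i).card) → (s.biUnion B).card ≤ m →
    (∀ q ⊆ s, 2 ≤ q.card → Module.finrank K ↥(⨆ i ∈ q, relSpace M (σ i) (B i)) <
      Module.finrank K (bigSpace M σ B q)) →
    ∑ i ∈ s, Module.finrank K (relSpace M (σ i) (B i)) ≤
      Module.finrank K ↥(⨆ i ∈ s, relSpace M (σ i) (B i))

/-- the specialization step -/
lemma spec_step {M : ℕ → J → K} (hM : SpecProp M) {m : ℕ} (hN : ∀ m' < m, NStat M m')
    (ι : Type) (s : Finset ι) (σ : ι → ℕ) (B : ι → Finset J)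
    (hσ : ∀ i ∈ s, σ i ≤ (B i).card) (hm : (s.biUnion B).card ≤ m)
    (hw1 : ∀ i ∈ s, σ i < (B i).card) (hs2 : s.Nonempty)
    (hlt : ∀ q ⊆ s, q ≠ s → 2 ≤ q.card →
      ∑ i ∈ q, Module.finrank K (relSpace M (σ i) (B i)) < Module.finrank K (bigSpace M σ B q))
    (hle : ∑ i ∈ s, Module.finrank K (relSpace M (σ i) (B i)) ≤
      Module.finrank K (bigSpace M σ B s)) :
    ∑ i ∈ s, Module.finrank K (relSpace M (σ i) (B i)) ≤
      Module.finrank K ↥(⨆ i ∈ s, relSpace M (σ i) (B i)) := by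
  classical
  obtain ⟨i0, hi0, hσ0⟩ := smin_mem σ hs2
  obtain ⟨j0, hj0⟩ : (B i0).Nonempty := Finset.card_pos.mp (by have := hw1 i0 hi0; omega)
  set B' : ι → Finset J := fun i => (B i).erase j0 with hB'
  set σ' : ι → ℕ := fun i => if j0 ∈ B i then σ i - 1 else σ i with hσ'
  have hσ'le : ∀ i, σ' i ≤ σ i := by
    intro i
    simp only [hσ']
    split_ifs <;> omega
  have hB'U : ∀ q : Finset ι, q.biUnion B' = (q.biUnion B).erase j0 := by
    intro q
    ext j
    simp only [hB', Finset.mem_biUnion, Finset.mem_erase]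
    constructor
    · rintro ⟨i, h1, h2, h3⟩; exact ⟨h2, i, h1, h3⟩
    · rintro ⟨h2, i, h1, h3⟩; exact ⟨i, h1, h2, h3⟩
  have hj0s : j0 ∈ s.biUnion B := Finset.mem_biUnion.mpr ⟨i0, hi0, hj0⟩
  have hcs : (s.biUnion B').card + 1 = (s.biUnion B).card := by
    rw [hB'U]
    exact Finset.card_erase_add_one hj0s
  have hσ'c : ∀ i ∈ s, σ' i ≤ (B' i).card := by
    intro i hi
    have h1 := hσ i hi
    by_cases h : j0 ∈ B i
    · have h2 := Finset.card_erase_add_one h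
      simp only [hσ', hB', h, if_true]
      omega
    · simp only [hσ', hB', h, if_false, Finset.erase_eq_of_notMem h]
      exact h1
  have hw : ∀ i ∈ s, Module.finrank K (relSpace M (σ i) (B i)) + σ i = (B i).card :=
    fun i hi => finrank_relSpace hM _ _ (hσ i hi)
  have hw' : ∀ i ∈ s, Module.finrank K (relSpace M (σ' i) (B' i)) + σ' i = (B' i).card :=
    fun i hi => finrank_relSpace hM _ _ (hσ'c i hi)
  have hw'le : ∀ i ∈ s, Module.finrank K (relSpace M (σ' i) (B' i)) ≤
      Module.finrank K (relSpace M (σ i) (B i)) := by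
    intro i hi
    have h1 := hw i hi
    have h2 := hw' i hi
    by_cases h : j0 ∈ B i
    · have h3 : (B' i).card + 1 = (B i).card := Finset.card_erase_add_one h
      have e1 : σ' i = σ i - 1 := if_pos h
      omega
    · have e1 : σ' i = σ i := if_neg h
      have e2 : B' i = B i := Finset.erase_eq_of_notMem h
      rw [e1, e2]
  have hS' : ∀ q ⊆ s, ∑ i ∈ q, Module.finrank K (relSpace M (σ' i) (B' i)) ≤
      ∑ i ∈ q, Module.finrank K (relSpace M (σ i) (B i)) :=
    fun q hq => Finset.sum_le_sum fun i hi => hw'le i (hq hi)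
  have hle' : ∀ q ⊆ s, q.Nonempty → ∑ i ∈ q, Module.finrank K (relSpace M (σ i) (B i)) ≤
      Module.finrank K (bigSpace M σ B q) := by
    intro q hq hqn
    by_cases hqs : q = s
    · rw [hqs]; exact hle
    · rcases Nat.lt_or_ge q.card 2 with h | h
      · have hpos := hqn.card_pos
        obtain ⟨i, rfl⟩ := Finset.card_eq_one.mp (show q.card = 1 by omega)
        rw [Finset.sum_singleton, bigSpace_singleton]
      · exact (hlt q hq hqs h).le
  have hind := hN ((s.biUnion B').card) (by omega) ι s σ' B' hσ'c le_rfl (by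
    intro q hq hqn
    have b1 := finrank_bigSpace hM hqn (fun i hi => hσ i (hq hi))
    have b2 := finrank_bigSpace hM hqn (fun i hi => hσ'c i (hq hi))
    have hcq : (q.biUnion B).card ≤ (q.biUnion B').card + 1 := by
      rw [hB'U]
      have := Finset.pred_card_le_card_erase (s := q.biUnion B) (a := j0)
      omega
    have hsm : smin σ' q ≤ smin σ q := by
      obtain ⟨i, hi, h⟩ := smin_mem σ hqn
      have := smin_le σ' hi
      have := hσ'le i
      omega
    have hSq := hS' q hq
    have hleq := hle' q hq hqn
    by_cases hz : σ i0 = 0 ∧ i0 ∈ q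
    · obtain ⟨hz, hiq⟩ := hz
      have h1 := smin_le σ hiq
      have h3 : ∑ i ∈ q, Module.finrank K (relSpace M (σ' i) (B' i)) <
          ∑ i ∈ q, Module.finrank K (relSpace M (σ i) (B i)) := by
        refine Finset.sum_lt_sum (fun i hi => hw'le i (hq hi)) ⟨i0, hiq, ?_⟩
        have h1 := hw i0 hi0
        have h2 := hw' i0 hi0
        have h3 : (B' i0).card + 1 = (B i0).card := Finset.card_erase_add_one hj0
        have h4 := hσ'le i0
        omega
      omega
    · by_cases hqs : q = s
      · have hz' : σ i0 ≠ 0 := fun h => hz ⟨h, by rw [hqs]; exact hi0⟩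
        have h1 : smin σ' q ≤ σ i0 - 1 := by
          have := smin_le σ' (show i0 ∈ q by rw [hqs]; exact hi0)
          have e1 : σ' i0 = σ i0 - 1 := if_pos hj0
          omega
        rw [hqs] at h1 b1 b2 hcq hSq hleq ⊢
        omega
      · rcases Nat.lt_or_ge q.card 2 with h | h
        · have hpos := hqn.card_pos
          obtain ⟨i, rfl⟩ := Finset.card_eq_one.mp (show q.card = 1 by omega)
          rw [Finset.sum_singleton, bigSpace_singleton]
        · have := hlt q hq hqs h
          omega)
  have hnr := no_rel_of_ind s _ hind
  refine ind_of_no_rel s _ fun y hy hsum => ?_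
  by_contra hcon
  push Not at hcon
  obtain ⟨u, h1, h2, h3, h4, h5⟩ := hM j0 ι s σ B y hy hcon
  have hu0 : ∑ i ∈ s, u i = 0 := h5 hsum
  -- at most one index with `σ = 0` contains `j0`
  have hne : ∀ i ∈ s, i ≠ i0 → u i j0 = 0 := by
    intro i hi hii
    by_cases hji : j0 ∈ B i
    · refine h3 i hi ?_
      by_contra h0
      have hσi : σ i = 0 := by omega
      have hσi0 : σ i0 = 0 := by have := smin_le σ hi; omega
      have hqs : ({i0, i} : Finset ι) ⊆ s := by
        intro a ha
        simp only [Finset.mem_insert, Finset.mem_singleton] at ha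
        rcases ha with rfl | rfl <;> assumption
      have hqn : ({i0, i} : Finset ι).Nonempty := ⟨i0, by simp⟩
      have l1 := hle' {i0, i} hqs hqn
      have l2 := finrank_bigSpace hM hqn (fun i hi => hσ i (hqs hi))
      rw [Finset.sum_pair (Ne.symm hii)] at l1
      have l3 := hw i hi
      have l4 := hw i0 hi0
      have l5 : ({i0, i} : Finset ι).biUnion B = B i0 ∪ B i := by
        simp [Finset.biUnion_insert]
      have l6 := Finset.card_union_add_card_inter (B i0) (B i)
      have l7 : 0 < (B i0 ∩ B i).card := Finset.card_pos.mpr ⟨j0, by simp [hj0, hji]⟩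
      rw [l5] at l2
      omega
    · exact h2 i hi j0 hji
  have hall : ∀ i ∈ s, u i j0 = 0 := by
    intro i hi
    by_cases hii : i = i0
    · subst hii
      have := congrFun hu0 j0
      rw [Finset.sum_apply, Finset.sum_eq_single_of_mem i hi (fun b hb hbi => hne b hb hbi)] at this
      exact this
    · exact hne i hi hii
  have := hnr u (by
    intro i hi
    refine ⟨fun j hj => ?_, fun t ht => h4 i hi t ?_⟩
    · by_cases hjj : j = j0
      · rw [hjj]; exact hall i hi
      · exact h2 i hi j fun h => hj (Finset.mem_erase.mpr ⟨hjj, h⟩)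
    · by_cases h : j0 ∈ B i
      · left
        simp only [hσ', h, if_true] at ht
        omega
      · right
        simp only [hσ', h, if_false] at ht
        exact ⟨h, ht⟩) hu0
  obtain ⟨i, hi, hui⟩ := h1
  exact hui (this i hi)

lemma LStat_of_NStat {M : ℕ → J → K} (hM : SpecProp M) {m : ℕ} (hN : ∀ m' < m, NStat M m') :
    LStat M m := by
  classical
  intro ι s σ B
  obtain ⟨c, hc⟩ : ∃ c, s.card + ∑ i ∈ s, (B i).card = c := ⟨_, rfl⟩
  induction c using Nat.strong_induction_on generalizing s B with
  | _ c ih =>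
  intro hσ hm hNG
  rcases Nat.lt_or_ge s.card 2 with h | h2
  · rcases Nat.eq_zero_or_pos s.card with h0 | h0
    · rw [Finset.card_eq_zero] at h0
      subst h0
      simp
    · obtain ⟨i, rfl⟩ := Finset.card_eq_one.mp (show s.card = 1 by omega)
      rw [Finset.sum_singleton, Finset.iSup_singleton]
  have hsn : s.Nonempty := Finset.card_pos.mp (by omega)
  have hw : ∀ i ∈ s, Module.finrank K (relSpace M (σ i) (B i)) + σ i = (B i).card :=
    fun i hi => finrank_relSpace hM _ _ (hσ i hi)
  have hproper : ∀ q ⊆ s, q ≠ s → ∑ i ∈ q, Module.finrank K (relSpace M (σ i) (B i)) ≤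
      Module.finrank K ↥(⨆ i ∈ q, relSpace M (σ i) (B i)) := by
    intro q hq hqs
    have hlt : q.card < s.card := Finset.card_lt_card (hq.ssubset_of_ne hqs)
    have hsum : ∑ i ∈ q, (B i).card ≤ ∑ i ∈ s, (B i).card := Finset.sum_le_sum_of_subset hq
    exact ih _ (by omega) q B rfl (fun i hi => hσ i (hq hi))
      ((Finset.card_le_card (Finset.biUnion_subset_biUnion_of_subset_left B hq)).trans hm)
      (fun q' hq' => hNG q' (hq'.trans hq))
  have hlt : ∀ q ⊆ s, q ≠ s → 2 ≤ q.card →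
      ∑ i ∈ q, Module.finrank K (relSpace M (σ i) (B i)) < Module.finrank K (bigSpace M σ B q) :=
    fun q hq hqs hq2 => (hproper q hq hqs).trans_lt (hNG q hq hq2)
  by_cases hw1 : ∀ i ∈ s, σ i < (B i).card
  swap
  · push Not at hw1
    obtain ⟨i, hi, hle⟩ := hw1
    have h1 := hw i hi
    have h0 : Module.finrank K (relSpace M (σ i) (B i)) = 0 := by omega
    have h3 := hproper (s.erase i) (Finset.erase_subset _ _) (fun h => by
      have := Finset.notMem_erase i s
      rw [h] at this
      exact this hi)
    rw [← Finset.add_sum_erase _ _ hi, h0, zero_add]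
    refine h3.trans (Submodule.finrank_mono ?_)
    exact iSup₂_le fun a ha => le_iSup₂_of_le a (Finset.mem_of_mem_erase ha) le_rfl
  by_cases hle : ∑ i ∈ s, Module.finrank K (relSpace M (σ i) (B i)) ≤
      Module.finrank K (bigSpace M σ B s)
  · exact spec_step hM hN ι s σ B hσ hm hw1 hsn hlt hle
  exfalso
  push Not at hle
  have hbs := finrank_bigSpace hM hsn hσ
  -- find an overlap
  obtain ⟨i, hi, j, hj, i', hi', hii, hj'⟩ : ∃ i ∈ s, ∃ j ∈ B i, ∃ i' ∈ s, i' ≠ i ∧ j ∈ B i' := by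
    by_contra hcon
    push Not at hcon
    have hdisj : (s.biUnion B).card = ∑ i ∈ s, (B i).card := by
      refine Finset.card_biUnion fun a ha b hb hab => ?_
      show Disjoint (B a) (B b)
      rw [Finset.disjoint_left]
      intro j hja hjb
      exact hcon a ha j hja b hb (Ne.symm hab) hjb
    have h1 : ∑ i ∈ s, Module.finrank K (relSpace M (σ i) (B i)) + ∑ i ∈ s, σ i =
        ∑ i ∈ s, (B i).card := by
      rw [← Finset.sum_add_distrib]
      exact Finset.sum_congr rfl hw
    obtain ⟨a, ha⟩ := hsn
    have h2 := smin_le σ ha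
    have h3 : σ a ≤ ∑ i ∈ s, σ i := Finset.single_le_sum (fun _ _ => Nat.zero_le _) ha
    omega
  set B' : ι → Finset J := Function.update B i ((B i).erase j) with hB'
  have hB'i : B' i = (B i).erase j := by simp [hB']
  have hB'n : ∀ a, a ≠ i → B' a = B a := fun a ha => by simp [hB', ha]
  have hB'sub : ∀ a, B' a ⊆ B a := by
    intro a
    by_cases ha : a = i
    · rw [ha, hB'i]; exact Finset.erase_subset _ _
    · rw [hB'n a ha]
  have hcard := Finset.card_erase_add_one hj
  have hBs : s.biUnion B' = s.biUnion B := by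
    apply le_antisymm
    · exact Finset.biUnion_mono fun a _ => hB'sub a
    · intro x hx
      obtain ⟨a, ha, hxa⟩ := Finset.mem_biUnion.mp hx
      by_cases hxj : x = j
      · subst hxj
        exact Finset.mem_biUnion.mpr ⟨i', hi', by rw [hB'n i' hii]; exact hj'⟩
      · refine Finset.mem_biUnion.mpr ⟨a, ha, ?_⟩
        by_cases hai : a = i
        · subst hai
          rw [hB'i]
          exact Finset.mem_erase.mpr ⟨hxj, hxa⟩
        · rw [hB'n a hai]; exact hxa
  have hσ' : ∀ a ∈ s, σ a ≤ (B' a).card := by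
    intro a ha
    by_cases hai : a = i
    · subst hai
      rw [hB'i]
      have := hw1 a ha
      omega
    · rw [hB'n a hai]; exact hσ a ha
  have hwi' : Module.finrank K (relSpace M (σ i) (B' i)) + 1 =
      Module.finrank K (relSpace M (σ i) (B i)) := by
    have h1 := finrank_relSpace hM _ _ (hσ' i hi)
    have h3 := hw i hi
    rw [hB'i] at h1 ⊢
    omega
  have hsum' : ∀ q : Finset ι, i ∈ q → ∑ a ∈ q, Module.finrank K (relSpace M (σ a) (B' a)) + 1 =
      ∑ a ∈ q, Module.finrank K (relSpace M (σ a) (B a)) := by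
    intro q hiq
    rw [← Finset.add_sum_erase _ _ hiq,
      ← Finset.add_sum_erase q (fun a => Module.finrank K (relSpace M (σ a) (B a))) hiq, ← hwi']
    have : ∑ a ∈ q.erase i, Module.finrank K (relSpace M (σ a) (B' a)) =
        ∑ a ∈ q.erase i, Module.finrank K (relSpace M (σ a) (B a)) :=
      Finset.sum_congr rfl fun a ha => by rw [hB'n a (Finset.ne_of_mem_erase ha)]
    rw [this]
    ring
  have hsup' : Module.finrank K ↥(⨆ a ∈ s, relSpace M (σ a) (B' a)) ≤
      Module.finrank K ↥(⨆ a ∈ s, relSpace M (σ a) (B a)) :=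
    Submodule.finrank_mono (iSup₂_mono fun a _ => relSpace_mono le_rfl (hB'sub a))
  have hbig : bigSpace M σ B' s = bigSpace M σ B s := by
    unfold bigSpace; rw [hBs]
  have hNGs := hNG s le_rfl h2
  have hind := ih (s.card + ∑ a ∈ s, (B' a).card) (by
      have : ∑ a ∈ s, (B' a).card < ∑ a ∈ s, (B a).card :=
        Finset.sum_lt_sum (fun a _ => Finset.card_le_card (hB'sub a))
          ⟨i, hi, by rw [hB'i]; omega⟩
      omega) s B' rfl hσ' (by rw [hBs]; exact hm) (by
      intro q hq hq2
      by_cases hqs : q = s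
      · rw [hqs, hbig]
        omega
      by_cases hiq : i ∈ q
      · have hqn : q.Nonempty := ⟨i, hiq⟩
        have b1 := finrank_bigSpace hM hqn (fun i hi => hσ i (hq hi))
        have b2 := finrank_bigSpace hM hqn (fun i hi => hσ' i (hq hi))
        have hsub : (q.biUnion B).erase j ⊆ q.biUnion B' := by
          intro x hx
          obtain ⟨hxj, hx⟩ := Finset.mem_erase.mp hx
          obtain ⟨a, ha, hxa⟩ := Finset.mem_biUnion.mp hx
          refine Finset.mem_biUnion.mpr ⟨a, ha, ?_⟩
          by_cases hai : a = i
          · subst hai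
            rw [hB'i]
            exact Finset.mem_erase.mpr ⟨hxj, hxa⟩
          · rw [hB'n a hai]; exact hxa
        have c1 := Finset.card_le_card hsub
        have c2 := Finset.pred_card_le_card_erase (s := q.biUnion B) (a := j)
        have c3 := hlt q hq hqs hq2
        have c4 := hsum' q hiq
        have c5 := finrank_biSup_le q (fun a => relSpace M (σ a) (B' a))
        omega
      · have e1 : ∀ a ∈ q, B' a = B a := fun a ha => hB'n a fun h => hiq (h ▸ ha)
        have e2 : q.biUnion B' = q.biUnion B := Finset.biUnion_congr rfl e1
        have e3 : (⨆ a ∈ q, relSpace M (σ a) (B' a)) = ⨆ a ∈ q, relSpace M (σ a) (B a) :=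
          iSup_congr fun a => iSup_congr fun ha => by rw [e1 a ha]
        have e4 : bigSpace M σ B' q = bigSpace M σ B q := by
          unfold bigSpace; rw [e2]
        rw [e3, e4]
        exact hNG q hq hq2)
  have := hsum' s hi
  omega

/-- existence of a good partition -/
lemma TStat_of_LStat {M : ℕ → J → K} (hM : SpecProp M) {m : ℕ} (hL : LStat M m)
    (ι : Type) [DecidableEq ι] (s : Finset ι) (σ : ι → ℕ) (B : ι → Finset J)
    (hσ : ∀ i ∈ s, σ i ≤ (B i).card) (hm : (s.biUnion B).card ≤ m) :
    ∃ P : Finpartition s, ∑ p ∈ P.parts, Module.finrank K (bigSpace M σ B p) ≤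
      Module.finrank K ↥(⨆ i ∈ s, relSpace M (σ i) (B i)) := by
  classical
  -- minimal good partition
  have hex : ∃ c : ℕ, ∃ P : Finpartition s, P.parts.card = c ∧
      ∀ p ∈ P.parts, bigSpace M σ B p = ⨆ i ∈ p, relSpace M (σ i) (B i) := by
    refine ⟨_, ⊥, rfl, ?_⟩
    intro p hp
    rw [Finpartition.mem_bot_iff] at hp
    obtain ⟨a, -, rfl⟩ := hp
    rw [bigSpace_singleton, Finset.iSup_singleton]
  obtain ⟨P, hPc, hP⟩ := Nat.find_spec hex
  have hmin := fun c (hc : c < Nat.find hex) => Nat.find_min hex hc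
  rw [← hPc] at hmin
  have hUn : ∀ Q ⊆ P.parts, (⨆ p ∈ Q, bigSpace M σ B p) =
      ⨆ i ∈ Q.sup id, relSpace M (σ i) (B i) := by
    intro Q hQ
    rw [Finset.sup_eq_biUnion, Finset.iSup_biUnion]
    exact iSup_congr fun p => iSup_congr fun hp => hP p (hQ hp)
  refine ⟨P, ?_⟩
  have hfin := hL (Finset ι) P.parts (smin σ) (fun p => p.biUnion B) (by
      intro p hp
      exact smin_le_card (P.nonempty_of_mem_parts hp) (fun i hi => hσ i (P.le hp hi))) (by
      rw [← Finset.biUnion_biUnion]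
      have : P.parts.biUnion (fun p => p) = s := by
        have := P.sup_parts
        rwa [Finset.sup_eq_biUnion] at this
      rw [this]
      exact hm) (by
      intro Q hQ hQ2
      by_contra hcon
      push Not at hcon
      have hQn : Q.Nonempty := Finset.card_pos.mp (by omega)
      have hmemQ : ∀ a, a ∈ Q.sup id ↔ ∃ p ∈ Q, a ∈ p := by
        intro a
        rw [Finset.sup_eq_biUnion, Finset.mem_biUnion]
        rfl
      have hSn : (Q.sup id).Nonempty := by
        obtain ⟨p, hp⟩ := hQn
        obtain ⟨a, ha⟩ := P.nonempty_of_mem_parts (hQ hp)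
        exact ⟨a, (hmemQ a).mpr ⟨p, hp, ha⟩⟩
      have e1 : smin (smin σ) Q = smin σ (Q.sup id) := by
        apply le_antisymm
        · obtain ⟨a, ha, h⟩ := smin_mem σ hSn
          obtain ⟨p, hp, hap⟩ := (hmemQ a).mp ha
          rw [← h]
          exact (smin_le (smin σ) hp).trans (smin_le σ hap)
        · obtain ⟨p, hp, h⟩ := smin_mem (smin σ) hQn
          obtain ⟨a, ha, h'⟩ := smin_mem σ (P.nonempty_of_mem_parts (hQ hp))
          rw [← h, ← h']
          exact smin_le σ ((hmemQ a).mpr ⟨p, hp, ha⟩)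
      have e2 : Q.biUnion (fun p => p.biUnion B) = (Q.sup id).biUnion B := by
        rw [Finset.sup_eq_biUnion, Finset.biUnion_biUnion]; rfl
      have e3 : bigSpace M (smin σ) (fun p => p.biUnion B) Q = bigSpace M σ B (Q.sup id) := by
        unfold bigSpace; rw [e1, e2]
      have e4 := hUn Q hQ
      have hgood : bigSpace M σ B (Q.sup id) = ⨆ i ∈ Q.sup id, relSpace M (σ i) (B i) := by
        symm
        refine Submodule.eq_of_le_of_finrank_le (le_bigSpace M σ B _) ?_
        rw [← e4, ← e3]
        exact hcon
      have hdisj : ∀ p ∈ P.parts, p ∉ Q → Disjoint (Q.sup id) p := by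
        intro p hp hpQ
        rw [Finset.disjoint_left]
        intro a ha hap
        obtain ⟨p', hp', hap'⟩ := (hmemQ a).mp ha
        have : p' = p := P.eq_of_mem_parts (hQ hp') hp hap' hap
        exact hpQ (this ▸ hp')
      let P' : Finpartition s :=
        { parts := insert (Q.sup id) (P.parts \ Q)
          supIndep := by
            rw [Finset.supIndep_iff_pairwiseDisjoint]
            intro a ha b hb hab
            simp only [Finset.coe_insert, Finset.coe_sdiff, Set.mem_insert_iff, Set.mem_sdiff,
              Finset.mem_coe] at ha hb
            show Disjoint a b
            rcases ha with rfl | ⟨ha, ha'⟩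
            · rcases hb with rfl | ⟨hb, hb'⟩
              · exact absurd rfl hab
              · exact hdisj b hb hb'
            · rcases hb with rfl | ⟨hb, hb'⟩
              · exact (hdisj a ha ha').symm
              · exact P.disjoint ha hb hab
          sup_parts := by
            rw [Finset.sup_insert, id, ← Finset.sup_union, Finset.union_sdiff_of_subset hQ]
            exact P.sup_parts
          bot_notMem := by
            intro h
            rcases Finset.mem_insert.mp h with h | h
            · rw [← h] at hSn
              exact Finset.not_nonempty_empty hSn
            · exact P.bot_notMem (Finset.mem_sdiff.mp h).1 }
      have hPc' : P'.parts.card < P.parts.card := by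
        have c1 : P'.parts.card ≤ (P.parts \ Q).card + 1 := Finset.card_insert_le _ _
        have c2 := Finset.card_sdiff_add_card_eq_card hQ
        omega
      refine hmin _ hPc' ⟨P', rfl, ?_⟩
      intro p hp
      rcases Finset.mem_insert.mp hp with h | h
      · rw [h]; exact hgood
      · exact hP p (Finset.mem_sdiff.mp h).1)
  refine hfin.trans ?_
  have := hUn P.parts le_rfl
  rw [P.sup_parts] at this
  rw [← this]
  exact le_rfl

end comb

section fin

variable {K : Type*} [Field K] {J : Type*} [Fintype J] [DecidableEq J]

lemma NStat_of_LStat {M : ℕ → J → K} (hM : SpecProp M) {m : ℕ} (hL : LStat M m) : NStat M m := by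
  classical
  intro ι s σ B hσ hm hq
  obtain ⟨P, hP⟩ := TStat_of_LStat hM hL ι s σ B hσ hm
  refine le_trans ?_ hP
  have h1 : ∑ i ∈ s, Module.finrank K (relSpace M (σ i) (B i)) =
      ∑ p ∈ P.parts, ∑ i ∈ p, Module.finrank K (relSpace M (σ i) (B i)) := by
    have h2 : P.parts.biUnion id = s := P.biUnion_parts
    conv_lhs => rw [← h2]
    rw [Finset.sum_biUnion P.disjoint]
    rfl
  rw [h1]
  exact Finset.sum_le_sum fun p hp => hq p (P.le hp) (P.nonempty_of_mem_parts hp)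

lemma NStat_all {M : ℕ → J → K} (hM : SpecProp M) (m : ℕ) : NStat M m := by
  induction m using Nat.strong_induction_on with
  | _ m ih => exact NStat_of_LStat hM (LStat_of_NStat hM ih)

lemma TStat_all {M : ℕ → J → K} (hM : SpecProp M)
    (ι : Type) [DecidableEq ι] (s : Finset ι) (σ : ι → ℕ) (B : ι → Finset J)
    (hσ : ∀ i ∈ s, σ i ≤ (B i).card) :
    ∃ P : Finpartition s, ∑ p ∈ P.parts, Module.finrank K (bigSpace M σ B p) ≤
      Module.finrank K ↥(⨆ i ∈ s, relSpace M (σ i) (B i)) :=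
  TStat_of_LStat hM (m := (s.biUnion B).card)
    (LStat_of_NStat hM fun m' _ => NStat_all hM m') ι s σ B hσ le_rfl

/-- the standard dot product bilinear form -/
def dotBil (K : Type*) [Field K] (n : ℕ) : LinearMap.BilinForm K (Fin n → K) :=
  dotProductBilin K K

lemma dotBil_apply {n : ℕ} (x y : Fin n → K) : dotBil K n x y = ∑ j, x j * y j := rfl

lemma dotBil_refl (n : ℕ) : (dotBil K n).IsRefl := by
  intro x y h
  rw [dotBil_apply] at h ⊢
  rw [← h]
  exact Finset.sum_congr rfl fun j _ => mul_comm _ _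

lemma dotBil_nondeg (n : ℕ) : (dotBil K n).Nondegenerate := by
  constructor
  · intro x hx
    funext j
    have := hx (Pi.single j 1)
    rw [dotBil_apply] at this
    simpa [Pi.single_apply] using this
  · intro x hx
    funext j
    have := hx (Pi.single j 1)
    rw [dotBil_apply] at this
    simpa [Pi.single_apply] using this

lemma orth_eq {n k : ℕ} (M : ℕ → Fin n → K) (V : Matrix (Fin k) (Fin n) K)
    (hMV : ∀ (i : Fin k) j, M i j = V i j) (σ : ℕ) (hσ : σ ≤ k) (A : Finset (Fin n)) :
    (dotBil K n).orthogonal (colSpanLT Vᵀ σ ⊔ colSpan (1 : Matrix (Fin n) (Fin n) K) A) =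
      relSpace M σ Aᶜ := by
  apply le_antisymm
  · intro y hy
    rw [LinearMap.BilinForm.mem_orthogonal_iff] at hy
    refine ⟨fun j hj => ?_, fun t ht => ?_⟩
    · have hj' : j ∈ A := by simpa using hj
      have h1 : (fun i => (1 : Matrix (Fin n) (Fin n) K) i j) ∈
          colSpan (1 : Matrix (Fin n) (Fin n) K) A :=
        Submodule.subset_span ⟨j, hj', rfl⟩
      have h2 := hy _ (Submodule.mem_sup_right h1)
      change dotBil K n _ y = 0 at h2
      rw [dotBil_apply] at h2
      simpa [Matrix.one_apply] using h2
    · have h1 : (fun i => Vᵀ i (⟨t, by omega⟩ : Fin k)) ∈ colSpanLT Vᵀ σ :=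
        Submodule.subset_span ⟨⟨t, by omega⟩, ht, rfl⟩
      have h2 := hy _ (Submodule.mem_sup_left h1)
      change dotBil K n _ y = 0 at h2
      rw [dotBil_apply] at h2
      rw [← h2]
      refine Finset.sum_congr rfl fun j _ => ?_
      rw [mul_comm, Matrix.transpose_apply, ← hMV]
  · have key : colSpanLT Vᵀ σ ⊔ colSpan (1 : Matrix (Fin n) (Fin n) K) A ≤
        (dotBil K n).orthogonal (relSpace M σ Aᶜ) := by
      refine sup_le (Submodule.span_le.mpr ?_) (Submodule.span_le.mpr ?_)
      · rintro _ ⟨t, ht, rfl⟩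
        rw [SetLike.mem_coe, LinearMap.BilinForm.mem_orthogonal_iff]
        rintro y ⟨-, hy⟩
        change dotBil K n y _ = 0
        rw [dotBil_apply, ← hy t ht]
        refine Finset.sum_congr rfl fun j _ => ?_
        change y j * V t j = y j * M t j
        rw [hMV]
      · rintro _ ⟨j, hj, rfl⟩
        rw [SetLike.mem_coe, LinearMap.BilinForm.mem_orthogonal_iff]
        rintro y ⟨hy, -⟩
        change dotBil K n y _ = 0
        rw [dotBil_apply]
        have := hy j (by simpa using hj)
        simpa [Matrix.one_apply] using this
    have := LinearMap.BilinForm.orthogonal_le (B := dotBil K n) key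
    rwa [LinearMap.BilinForm.orthogonal_orthogonal (dotBil_nondeg n) (dotBil_refl n)] at this

lemma main_abstract {n k : ℕ} (M : ℕ → Fin n → K) (hM : SpecProp M) (V : Matrix (Fin k) (Fin n) K)
    (hMV : ∀ (i : Fin k) j, M i j = V i j) {ℓ : ℕ} (σ : Fin ℓ → ℕ)
    (A : Fin ℓ → Finset (Fin n)) (hσ : ∀ i, σ i ≤ k) (hA : ∀ i, σ i + (A i).card ≤ n) :
    (Module.finrank K ↥(⨅ i, colSpanLT Vᵀ (σ i) ⊔
        colSpan (1 : Matrix (Fin n) (Fin n) K) (A i)) : ℤ) = gid n σ A := by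
  classical
  set U : Fin ℓ → Submodule K (Fin n → K) := fun i => colSpanLT Vᵀ (σ i) ⊔
        colSpan (1 : Matrix (Fin n) (Fin n) K) (A i) with hU
  set B : Fin ℓ → Finset (Fin n) := fun i => (A i)ᶜ with hB
  have hWU : ∀ i, (dotBil K n).orthogonal (U i) = relSpace M (σ i) (B i) :=
    fun i => orth_eq M V hMV (σ i) (hσ i) (A i)
  have hσB : ∀ i, σ i ≤ (B i).card := by
    intro i
    have h1 := hA i
    have h2 : (B i).card = n - (A i).card := by
      rw [hB, Finset.card_compl, Fintype.card_fin]
    omega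
  have hinf : (⨅ i, U i) = (dotBil K n).orthogonal (⨆ i ∈ (Finset.univ : Finset (Fin ℓ)),
      relSpace M (σ i) (B i)) := by
    apply le_antisymm
    · have h1 : (⨆ i ∈ (Finset.univ : Finset (Fin ℓ)), relSpace M (σ i) (B i)) ≤
          (dotBil K n).orthogonal (⨅ i, U i) := by
        refine iSup₂_le fun i _ => ?_
        rw [← hWU i]
        exact LinearMap.BilinForm.orthogonal_le (iInf_le _ i)
      have := LinearMap.BilinForm.orthogonal_le (B := dotBil K n) h1
      rwa [LinearMap.BilinForm.orthogonal_orthogonal (dotBil_nondeg n) (dotBil_refl n)] at this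
    · refine le_iInf fun i => ?_
      have h1 : relSpace M (σ i) (B i) ≤ ⨆ i ∈ (Finset.univ : Finset (Fin ℓ)),
          relSpace M (σ i) (B i) :=
        le_iSup₂_of_le i (Finset.mem_univ i) le_rfl
      have := LinearMap.BilinForm.orthogonal_le (B := dotBil K n) h1
      rwa [← hWU i,
        LinearMap.BilinForm.orthogonal_orthogonal (dotBil_nondeg n) (dotBil_refl n)] at this
  obtain ⟨D, hD⟩ : ∃ D, Module.finrank K ↥(⨆ i ∈ (Finset.univ : Finset (Fin ℓ)),
      relSpace M (σ i) (B i)) = D := ⟨_, rfl⟩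
  have hfr : Module.finrank K ↥(⨅ i, U i) + D = n := by
    have h1 := LinearMap.BilinForm.finrank_orthogonal (dotBil_nondeg (K := K) n)
      (⨆ i ∈ (Finset.univ : Finset (Fin ℓ)), relSpace M (σ i) (B i))
    have h2 := Submodule.finrank_le (⨆ i ∈ (Finset.univ : Finset (Fin ℓ)),
      relSpace M (σ i) (B i))
    rw [← hinf] at h1
    rw [Module.finrank_fin_fun, hD] at h1 h2
    omega
  have hpart : ∀ p : Finset (Fin ℓ), p.Nonempty →
      ((partMin σ p : ℤ) + ((interSet A p).card : ℤ)) =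
        n - Module.finrank K (bigSpace M σ B p) := by
    intro p hp
    have h1 := finrank_bigSpace hM hp (fun i _ => hσB i)
    have h2 : p.biUnion B = (interSet A p)ᶜ := by
      ext x
      simp [hB, interSet]
    have h3 : (interSet A p)ᶜ.card + (interSet A p).card = n := by
      have := Finset.card_compl_add_card (interSet A p)
      rwa [Fintype.card_fin] at this
    have h4 : smin σ p = partMin σ p := rfl
    rw [h2, h4] at h1
    omega
  have hval : ∀ P : Finpartition (Finset.univ : Finset (Fin ℓ)),
      -(n : ℤ) * ((P.parts.card : ℤ) - 1)
      + ∑ p ∈ P.parts, ((partMin σ p : ℤ) + ((interSet A p).card : ℤ)) =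
      n - ((∑ p ∈ P.parts, Module.finrank K (bigSpace M σ B p) : ℕ) : ℤ) := by
    intro P
    rw [Finset.sum_congr rfl fun p hp => hpart p (P.nonempty_of_mem_parts hp),
      Finset.sum_sub_distrib, Finset.sum_const, nsmul_eq_mul]
    push_cast
    ring
  have hge : ∀ P : Finpartition (Finset.univ : Finset (Fin ℓ)),
      D ≤ ∑ p ∈ P.parts, Module.finrank K (bigSpace M σ B p) := by
    intro P
    rw [← hD]
    refine le_trans (Submodule.finrank_mono ?_)
      (finrank_biSup_le P.parts (fun p => bigSpace M σ B p))
    refine iSup₂_le fun i hi => ?_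
    obtain ⟨p, hp, hip⟩ := P.exists_mem hi
    refine le_iSup₂_of_le p hp (le_trans ?_ (le_bigSpace M σ B p))
    exact le_iSup₂_of_le (f := fun i (_ : i ∈ p) => relSpace M (σ i) (B i)) i hip le_rfl
  obtain ⟨P, hP⟩ := TStat_all hM (Fin ℓ) Finset.univ σ B (fun i _ => hσB i)
  rw [hD] at hP
  have hgr : IsGreatest { v : ℤ | ∃ P : Finpartition (Finset.univ : Finset (Fin ℓ)),
    v = -(n : ℤ) * ((P.parts.card : ℤ) - 1)
      + ∑ p ∈ P.parts, ((partMin σ p : ℤ) + ((interSet A p).card : ℤ)) }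
      (Module.finrank K ↥(⨅ i, U i) : ℤ) := by
    constructor
    · refine ⟨P, ?_⟩
      rw [hval]
      have := hge P
      omega
    · rintro v ⟨Q, rfl⟩
      rw [hval]
      have := hge Q
      omega
  exact hgr.csSup_eq.symm

end fin


/-- For a generic monomial matrix `V`, the pair `(Vᵀ, I_n)` is `MDSb(ℓ)` for all `ℓ ≥ 1`:
the dimension of `⋂_i (R_{≤σ_i} + E_{A_i})` equals `gid_n((σ_i, A_i)_i)`, where `R_{≤σ}`
is the span of the first `σ` rows of `V` and `E_A` the span of the standard basis vectors
indexed by `A`. -/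
theorem generic_monomial_transpose_MDSb
    (F : Type*) [Field F] (k n : ℕ) (hk : 1 ≤ k) (hkn : k ≤ n)
    (e : Fin k → ℤ) (he : StrictMono e)
    (V : Matrix (Fin k) (Fin n) (FractionRing (MvPolynomial (Fin n) F)))
    (hV : ∀ i j, V i j =
      (algebraMap (MvPolynomial (Fin n) F) (FractionRing (MvPolynomial (Fin n) F))
        (MvPolynomial.X j)) ^ (e i)) :
    ∀ ℓ : ℕ, 1 ≤ ℓ → ∀ (σ : Fin ℓ → ℕ) (A : Fin ℓ → Finset (Fin n)),
      (∀ i, σ i ≤ k) → (∀ i, σ i + (A i).card ≤ n) →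
      (Module.finrank (FractionRing (MvPolynomial (Fin n) F))
        ↥(⨅ i, colSpanLT Vᵀ (σ i) ⊔
            colSpan (1 : Matrix (Fin n) (Fin n) (FractionRing (MvPolynomial (Fin n) F)))
              (A i)) : ℤ)
        = gid n σ A := by
  intro ℓ _ σ A hσ hA
  let e' : ℕ → ℤ := fun t => if h : t < k then e ⟨t, h⟩ else e ⟨k - 1, by omega⟩ + t
  have he' : StrictMono e' := by
    apply strictMono_nat_of_lt_succ
    intro t
    by_cases h1 : t + 1 < k
    · have h2 : t < k := by omega
      simp only [e', h1, h2, dif_pos]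
      exact he (by simp)
    · by_cases h2 : t < k
      · have h3 : e ⟨t, h2⟩ = e ⟨k - 1, by omega⟩ := by
          congr 2
          omega
        simp only [e', h1, h2, dif_pos, dif_neg, not_false_eq_true, h3]
        push_cast
        omega
      · simp only [e', h1, h2, dif_neg, not_false_eq_true]
        push_cast
        omega
  refine main_abstract (fun t j => (algebraMap (MvPolynomial (Fin n) F)
    (FractionRing (MvPolynomial (Fin n) F)) (MvPolynomial.X j)) ^ e' t)
    (specProp_generic F e' he') V ?_ σ A hσ hA
  intro i j
  rw [hV]
  simp only [e', i.isLt, dif_pos]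
end
end
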